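/- arXiv:0706.4072 — 4 statements merged into one kernel-verified Lean document; each statement's English description precedes it below -/
import Mathlib

section
/- First Rogers–Ramanujan identity (combinatorial form): for every nonnegative integer n, the number of partitions of n whose parts are all congruent to 1 or 4 modulo 5 equals the number of partitions of n whose successive parts differ by at least 2 (equivalently, partitions b₁ ≥ b₂ ≥ ⋯ ≥ b_s of n with b_j − b_{j+1} ≥ 2 for all 1 ≤ j < s). -/
namespace RR
open Finset

section field
variable {K : Type*} [Field K]

/-- reciprocal of the q-factorial, zero at negative integers -/
noncomputable def qc (q : K) (n : ℤ) : K :=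
  if 0 ≤ n then (∏ i ∈ range n.toNat, (1 - q ^ (i + 1)))⁻¹ else 0

lemma qc_neg (q : K) {n : ℤ} (h : n < 0) : qc q n = 0 := by
  simp [qc, not_le.mpr h]

lemma qc_zero (q : K) : qc q 0 = 1 := by simp [qc]

lemma qc_nat (q : K) (n : ℕ) : qc q n = (∏ i ∈ range n, (1 - q ^ (i + 1)))⁻¹ := by
  simp [qc]

lemma qc_step {q : K} (hq : ∀ n : ℕ, q ^ (n + 1) ≠ 1) (n : ℤ) :
    (1 - q ^ n) * qc q n = qc q (n - 1) := by
  rcases lt_trichotomy n 0 with h | h | h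
  · rw [qc_neg q h, qc_neg q (by omega), mul_zero]
  · subst h
    rw [qc_neg q (n := 0 - 1) (by omega)]; simp
  · obtain ⟨k, rfl⟩ : ∃ k : ℕ, n = (k : ℤ) + 1 := ⟨(n - 1).toNat, by omega⟩
    have h1 : (k : ℤ) + 1 = ((k + 1 : ℕ) : ℤ) := by push_cast; rfl
    rw [add_sub_cancel_right, h1, qc_nat, qc_nat, zpow_natCast, prod_range_succ, mul_inv]
    have : 1 - q ^ (k + 1) ≠ 0 := sub_ne_zero.mpr (hq k).symm
    field_simp

lemma qc_step' {q : K} (hq : ∀ n : ℕ, q ^ (n + 1) ≠ 1) (n : ℤ) :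
    qc q (n - 1) = (1 - q ^ n) * qc q n := (qc_step hq n).symm

lemma one_sub_ne {q : K} (hq : ∀ n : ℕ, q ^ (n + 1) ≠ 1) {n : ℤ} (hn : 0 < n) :
    1 - q ^ n ≠ 0 := by
  obtain ⟨k, rfl⟩ : ∃ k : ℕ, n = (k : ℤ) + 1 := ⟨(n - 1).toNat, by omega⟩
  have h1 : (k : ℤ) + 1 = ((k + 1 : ℕ) : ℤ) := by push_cast; rfl
  rw [h1, zpow_natCast]
  exact sub_ne_zero.mpr (hq k).symm

lemma supp_fin (f : ℤ → K) (q : K) (a b : ℤ) (g : ℤ → K) (hf : ∀ j, f j = g j * (qc q (a - j) * qc q (b + j))) :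
    (Function.support f).Finite := by
  apply (Set.finite_Icc (-b) a).subset
  intro j hj
  rw [Function.mem_support, hf] at hj
  constructor
  · by_contra h
    apply hj; rw [qc_neg q (n := b + j) (by omega)]; simp
  · by_contra h
    apply hj; rw [qc_neg q (n := a - j) (by omega)]; simp

/-- q-Vandermonde sum -/
noncomputable def qF (q : K) (n m : ℤ) : K :=
  ∑ᶠ t : ℤ, q ^ (t * (t + m)) * qc q (t + m) * (qc q (n - t) * qc q (0 + t))

lemma qF_step {q : K} (h0 : q ≠ 0) (hq : ∀ n : ℕ, q ^ (n + 1) ≠ 1) (n m : ℤ) :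
    (1 - q ^ n) * qF q n m = qF q (n - 1) m + q ^ (n + m) * qF q (n - 1) (m + 1) := by
  have h2 : q ^ (n + m) * qF q (n - 1) (m + 1) = ∑ᶠ t : ℤ, q ^ (n + m) *
      (q ^ ((t - 1) * ((t - 1) + (m + 1))) * qc q ((t - 1) + (m + 1)) *
        (qc q (n - 1 - (t - 1)) * qc q (0 + (t - 1)))) := by
    rw [qF, mul_finsum' _ _ (supp_fin _ q (n - 1) 0 _ fun j => rfl),
      ← finsum_comp_equiv (Equiv.subRight (1 : ℤ))]
    rfl
  rw [h2, qF, qF, mul_finsum' _ _ (supp_fin _ q n 0 _ fun j => rfl), ← finsum_add_distrib]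
  · apply finsum_congr
    intro t
    have e1 : n - 1 - t = (n - t) - 1 := by ring
    have e2 : n - 1 - (t - 1) = n - t := by ring
    have e3 : (0 : ℤ) + (t - 1) = (0 + t) - 1 := by ring
    have e4 : t - 1 + (m + 1) = t + m := by ring
    rw [e1, e2, e3, e4, qc_step' hq, qc_step' hq]
    have e5 : q ^ n = q ^ (n - t) * q ^ t := by rw [← zpow_add₀ h0]; congr 1; ring
    have e6 : q ^ (n + m) * (q ^ ((t - 1) * (t + m))) = q ^ (n - t) * q ^ (t * (t + m)) := by
      rw [← zpow_add₀ h0, ← zpow_add₀ h0]; congr 1; ring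
    rw [e5, zero_add]
    linear_combination (- (qc q (t + m) * qc q (n - t) * (1 - q ^ t) * qc q t)) * e6
  · exact supp_fin _ q (n - 1) 0 _ fun j => rfl
  · apply supp_fin _ q n (-1) (fun t => q ^ (n + m) *
      (q ^ ((t - 1) * ((t - 1) + (m + 1))) * qc q ((t - 1) + (m + 1))))
    intro t
    have e2 : n - 1 - (t - 1) = n - t := by ring
    have e3 : (0 : ℤ) + (t - 1) = -1 + t := by ring
    rw [e2, e3]; ring

lemma qF_neg (q : K) {n : ℤ} (hn : n < 0) (m : ℤ) : qF q n m = 0 := by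
  rw [qF]
  apply finsum_eq_zero_of_forall_eq_zero
  intro t
  by_cases h : t < 0
  · rw [qc_neg q (n := 0 + t) (by omega)]; simp
  · rw [qc_neg q (n := n - t) (by omega)]; simp

lemma qF_eq {q : K} (h0 : q ≠ 0) (hq : ∀ n : ℕ, q ^ (n + 1) ≠ 1) (n m : ℤ) :
    qF q n m = qc q n * qc q (n + m) := by
  by_cases hn : n < 0
  · rw [qF_neg q hn, qc_neg q hn, zero_mul]
  obtain ⟨k, rfl⟩ := Int.eq_ofNat_of_zero_le (not_lt.mp hn)
  clear hn
  induction k generalizing m with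
  | zero =>
    rw [qF, finsum_eq_single _ 0]
    · simp [qc_zero]
    · intro t ht
      by_cases h : t < 0
      · rw [qc_neg q (n := 0 + t) (by omega)]; simp
      · rw [qc_neg q (n := ((0 : ℕ) : ℤ) - t) (by push_cast; omega)]; simp
  | succ k ih =>
    have h1 := qF_step h0 hq ((k + 1 : ℕ) : ℤ) m
    have e : ((k + 1 : ℕ) : ℤ) - 1 = k := by push_cast; ring
    rw [e, ih, ih] at h1
    have e2 : (k : ℤ) + m = ((k + 1 : ℕ) : ℤ) + m - 1 := by push_cast; ring
    have e3 : (k : ℤ) + (m + 1) = ((k + 1 : ℕ) : ℤ) + m := by push_cast; ring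
    rw [e2, e3, qc_step' hq, ← e, qc_step' hq] at h1
    have hne := one_sub_ne hq (n := ((k + 1 : ℕ) : ℤ)) (by push_cast; omega)
    apply mul_left_cancel₀ hne
    rw [h1]; ring

lemma qF_eq' {q : K} (h0 : q ≠ 0) (hq : ∀ n : ℕ, q ^ (n + 1) ≠ 1) (N : ℕ) (j : ℤ) :
    q ^ (j * j) * (qc q (N - j) * qc q (N + j)) =
      ∑ s ∈ Icc (-N : ℤ) N, q ^ (s * s) * qc q (N - s) * (qc q (s - j) * qc q (s + j)) := by
  have h := qF_eq h0 hq (N - j) (2 * j)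
  have e : (N : ℤ) - j + 2 * j = N + j := by ring
  rw [e] at h
  rw [← h, qF, mul_finsum' _ _ (supp_fin _ q _ 0 _ fun j => rfl),
    ← finsum_comp_equiv (Equiv.subRight j), finsum_eq_sum_of_support_subset]
  · apply sum_congr rfl
    intro s _
    simp only [Equiv.subRight_apply]
    have e1 : s - j + 2 * j = s + j := by ring
    have e2 : (N : ℤ) - j - (s - j) = N - s := by ring
    have e3 : q ^ (j * j) * q ^ ((s - j) * (s + j)) = q ^ (s * s) := by
      rw [← zpow_add₀ h0]; congr 1; ring
    rw [e1, e2, zero_add, ← e3]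
    ring
  · intro s hs
    rw [Function.mem_support] at hs
    simp only [Equiv.subRight_apply] at hs
    have e1 : s - j + 2 * j = s + j := by ring
    have e2 : (N : ℤ) - j - (s - j) = N - s := by ring
    rw [e1, e2, zero_add] at hs
    rw [coe_Icc]
    by_contra hc
    apply hs
    by_cases h3 : s > N
    · rw [qc_neg q (n := N - s) (by omega)]; simp
    · by_cases h4 : s + j < 0
      · rw [qc_neg q h4]; simp
      · rw [qc_neg q (n := s - j)]
        · simp
        · simp only [Set.mem_Icc, not_and_or] at hc
          omega

/-- One Bailey step -/
lemma bailey {q : K} (h0 : q ≠ 0) (hq : ∀ n : ℕ, q ^ (n + 1) ≠ 1) (α : ℤ → K) (N : ℕ) :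
    ∑ᶠ j : ℤ, α j * q ^ (j * j) * (qc q (N - j) * qc q (N + j)) =
      ∑ s ∈ Icc (-N : ℤ) N, q ^ (s * s) * qc q (N - s) *
        ∑ᶠ j : ℤ, α j * (qc q (s - j) * qc q (s + j)) := by
  have key : ∀ s ∈ Icc (-N : ℤ) N, ∀ g : ℤ → K,
      ∑ᶠ j : ℤ, g j * (qc q (s - j) * qc q (s + j)) =
        ∑ j ∈ Icc (-N : ℤ) N, g j * (qc q (s - j) * qc q (s + j)) := by
    intro s hs g
    apply finsum_eq_sum_of_support_subset
    intro j hj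
    rw [Function.mem_support] at hj
    rw [mem_Icc] at hs
    rw [coe_Icc]
    by_contra hc
    apply hj
    simp only [Set.mem_Icc, not_and_or] at hc
    by_cases h4 : s + j < 0
    · rw [qc_neg q h4]; simp
    · rw [qc_neg q (n := s - j) (by omega)]; simp
  rw [key N (by simp)]
  have h2 : ∑ s ∈ Icc (-N : ℤ) N, q ^ (s * s) * qc q (N - s) *
        ∑ᶠ j : ℤ, α j * (qc q (s - j) * qc q (s + j)) =
      ∑ s ∈ Icc (-N : ℤ) N, q ^ (s * s) * qc q (N - s) *
        ∑ j ∈ Icc (-N : ℤ) N, α j * (qc q (s - j) * qc q (s + j)) :=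
    sum_congr rfl (fun s hs => by rw [key s hs])
  rw [h2]
  simp_rw [mul_sum]
  rw [sum_comm]
  apply sum_congr rfl
  intro j _
  rw [mul_assoc, qF_eq' h0 hq, mul_sum]
  apply sum_congr rfl
  intro s _
  ring

/-- finite theta sums -/
noncomputable def qS (q z : K) (a b : ℤ) : K :=
  ∑ᶠ j : ℤ, (-z) ^ j * q ^ (j * (j - 1) / 2) * (qc q (a - j) * qc q (b + j))

lemma tri (j : ℤ) : (j + 1) * j / 2 = j * (j - 1) / 2 + j := by
  have : (j + 1) * j = j * (j - 1) + j * 2 := by ring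
  rw [this, Int.add_mul_ediv_right _ _ (by norm_num)]

lemma qS_step1 {q z : K} (h0 : q ≠ 0) (hz : z ≠ 0) (hq : ∀ n : ℕ, q ^ (n + 1) ≠ 1) (a b : ℤ) :
    (1 - q ^ (a + b)) * qS q z a b = (1 - z * q ^ (a - 1)) * qS q z (a - 1) b := by
  have hz' : -z ≠ 0 := neg_ne_zero.mpr hz
  have h2 : -(z * q ^ (a - 1)) * qS q z (a - 1) b = ∑ᶠ j : ℤ, -(z * q ^ (a - 1)) *
      ((-z) ^ (j - 1) * q ^ ((j - 1) * ((j - 1) - 1) / 2) *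
        (qc q (a - 1 - (j - 1)) * qc q (b + (j - 1)))) := by
    rw [qS, mul_finsum' _ _ (supp_fin _ q (a - 1) b _ fun j => rfl),
      ← finsum_comp_equiv (Equiv.subRight (1 : ℤ))]
    rfl
  rw [sub_mul 1 (z * _), one_mul, sub_eq_add_neg (qS q z (a - 1) b), ← neg_mul, h2, qS, qS,
    mul_finsum' _ _ (supp_fin _ q a b _ fun j => rfl), ← finsum_add_distrib]
  · apply finsum_congr
    intro j
    have e1 : a - 1 - j = (a - j) - 1 := by ring
    have e2 : a - 1 - (j - 1) = a - j := by ring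
    have e3 : b + (j - 1) = (b + j) - 1 := by ring
    rw [e1, e2, e3, qc_step' hq, qc_step' hq]
    have e5 : q ^ (a + b) = q ^ (a - j) * q ^ (b + j) := by rw [← zpow_add₀ h0]; congr 1; ring
    have e6 : (-z) ^ j = (-z) ^ (j - 1) * (-z) := by
      rw [← zpow_add_one₀ hz']; congr 1; ring
    have e7 : j * (j - 1) / 2 = (j - 1) * ((j - 1) - 1) / 2 + (j - 1) := by
      rw [← tri (j - 1)]; congr 1; ring
    have e8 : q ^ (a - 1) = q ^ (a - j) * q ^ (j - 1) := by
      rw [← zpow_add₀ h0]; congr 1; ring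
    rw [e5, e6, e7, e8, zpow_add₀ h0 _ (j - 1)]
    ring
  · exact supp_fin _ q (a - 1) b _ fun j => rfl
  · apply supp_fin _ q a (b - 1) (fun j => -(z * q ^ (a - 1)) *
      ((-z) ^ (j - 1) * q ^ ((j - 1) * ((j - 1) - 1) / 2)))
    intro j
    have e2 : a - 1 - (j - 1) = a - j := by ring
    have e3 : b + (j - 1) = b - 1 + j := by ring
    rw [e2, e3]; ring

lemma qS_step2 {q z : K} (h0 : q ≠ 0) (hz : z ≠ 0) (hq : ∀ n : ℕ, q ^ (n + 1) ≠ 1) (a b : ℤ) :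
    (1 - q ^ (a + b)) * qS q z a b = (1 - z⁻¹ * q ^ b) * qS q z a (b - 1) := by
  have hz' : -z ≠ 0 := neg_ne_zero.mpr hz
  have h2 : -(z⁻¹ * q ^ b) * qS q z a (b - 1) = ∑ᶠ j : ℤ, -(z⁻¹ * q ^ b) *
      ((-z) ^ (j + 1) * q ^ ((j + 1) * ((j + 1) - 1) / 2) *
        (qc q (a - (j + 1)) * qc q (b - 1 + (j + 1)))) := by
    rw [qS, mul_finsum' _ _ (supp_fin _ q a (b - 1) _ fun j => rfl),
      ← finsum_comp_equiv (Equiv.addRight (1 : ℤ))]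
    rfl
  rw [sub_mul 1 (z⁻¹ * _), one_mul, sub_eq_add_neg (qS q z a (b - 1)), ← neg_mul, h2, qS, qS,
    mul_finsum' _ _ (supp_fin _ q a b _ fun j => rfl), ← finsum_add_distrib]
  · apply finsum_congr
    intro j
    have e1 : a - (j + 1) = (a - j) - 1 := by ring
    have e2 : b - 1 + (j + 1) = b + j := by ring
    have e3 : b - 1 + j = (b + j) - 1 := by ring
    have e4 : j + 1 - 1 = j := by ring
    rw [e1, e2, e3, e4, qc_step' hq, qc_step' hq]
    have e5 : q ^ (a + b) = q ^ (a - j) * q ^ (b + j) := by rw [← zpow_add₀ h0]; congr 1; ring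
    rw [e5, tri, zpow_add_one₀ hz', zpow_add₀ h0 (j * (j - 1) / 2) j, zpow_add₀ h0 b j]
    field_simp
    ring
  · exact supp_fin _ q a (b - 1) _ fun j => rfl
  · apply supp_fin _ q (a - 1) b (fun j => -(z⁻¹ * q ^ b) *
      ((-z) ^ (j + 1) * q ^ ((j + 1) * ((j + 1) - 1) / 2)))
    intro j
    have e2 : a - (j + 1) = a - 1 - j := by ring
    have e3 : b - 1 + (j + 1) = b + j := by ring
    rw [e2, e3]; ring

lemma qS_zero (q z : K) : qS q z 0 0 = 1 := by
  rw [qS, finsum_eq_single _ 0]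
  · simp [qc_zero]
  · intro t ht
    by_cases h : t < 0
    · rw [qc_neg q (n := 0 + t) (by omega)]; simp
    · rw [qc_neg q (n := 0 - t) (by omega)]; simp

lemma qS_neg (q z : K) {t : ℤ} (ht : t < 0) : qS q z t t = 0 := by
  rw [qS]
  apply finsum_eq_zero_of_forall_eq_zero
  intro j
  by_cases h : t + j < 0
  · rw [qc_neg q h]; simp
  · rw [qc_neg q (n := t - j) (by omega)]; simp

lemma qS_vanish {q : K} (h0 : q ≠ 0) (hq : ∀ n : ℕ, q ^ (n + 1) ≠ 1) (a b : ℕ) :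
    qS q q a (b + 1) = 0 := by
  have hne := one_sub_ne hq (n := (a : ℤ) + (b + 1)) (by omega)
  have h := qS_step2 h0 h0 hq a (b + 1)
  induction b with
  | zero =>
    simp only [Nat.cast_zero, zero_add] at *
    rw [zpow_one, inv_mul_cancel₀ h0, sub_self, zero_mul] at h
    exact (mul_eq_zero.mp h).resolve_left hne
  | succ b ih =>
    have e : (((b + 1 : ℕ) : ℤ) + 1) - 1 = (b : ℤ) + 1 := by push_cast; ring
    rw [e, ih, mul_zero] at h
    · exact (mul_eq_zero.mp h).resolve_left hne
    · exact one_sub_ne hq (by omega)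
    · exact qS_step2 h0 h0 hq a (b + 1)

lemma qS_diag {q : K} (h0 : q ≠ 0) (hq : ∀ n : ℕ, q ^ (n + 1) ≠ 1) (t : ℤ) :
    qS q q t t = if t = 0 then 1 else 0 := by
  rcases lt_trichotomy t 0 with h | h | h
  · rw [qS_neg q q h, if_neg (by omega)]
  · subst h; simp [qS_zero]
  · obtain ⟨k, rfl⟩ : ∃ k : ℕ, t = (k : ℤ) + 1 := ⟨(t - 1).toNat, by omega⟩
    rw [if_neg (by omega)]
    have := qS_vanish h0 hq (k + 1) k
    push_cast at this
    exact this

/-- finite Rogers-Ramanujan -/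
lemma finite_RR {q : K} (h0 : q ≠ 0) (hq : ∀ n : ℕ, q ^ (n + 1) ≠ 1) (N : ℕ) :
    ∑ᶠ j : ℤ, (-q) ^ j * q ^ (j * (j - 1) / 2) * q ^ (j * j) * q ^ (j * j) *
      (qc q (N - j) * qc q (N + j)) =
    ∑ s ∈ Icc (-N : ℤ) N, q ^ (s * s) * qc q (N - s) * qc q s := by
  rw [bailey h0 hq]
  apply sum_congr rfl
  intro s hs
  congr 1
  by_cases h : s < 0
  · rw [qc_neg q h]
    apply finsum_eq_zero_of_forall_eq_zero
    intro j
    by_cases h : s + j < 0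
    · rw [qc_neg q h]; simp
    · rw [qc_neg q (n := s - j) (by omega)]; simp
  obtain ⟨k, rfl⟩ := Int.eq_ofNat_of_zero_le (not_lt.mp h)
  rw [bailey h0 hq, sum_eq_single 0]
  · have := qS_diag h0 hq 0
    rw [qS] at this
    rw [this]; simp
  · intro t _ ht
    have := qS_diag h0 hq t
    rw [qS, if_neg ht] at this
    rw [this, mul_zero]
  · intro h
    simp at h

/-- finite Jacobi triple product -/
lemma finite_JTP {q z : K} (h0 : q ≠ 0) (hz : z ≠ 0) (hq : ∀ n : ℕ, q ^ (n + 1) ≠ 1) (N : ℕ) :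
    qS q z N N = qc q (2 * N) * ∏ i ∈ range N, ((1 - z * q ^ i) * (1 - z⁻¹ * q ^ (i + 1))) := by
  induction N with
  | zero => simp [qS_zero, qc_zero]
  | succ N ih =>
    rw [prod_range_succ]
    have h1 := qS_step1 h0 hz hq (N + 1) (N + 1)
    have h2 := qS_step2 h0 hz hq N (N + 1)
    have n1 := one_sub_ne hq (n := (N : ℤ) + 1 + (N + 1)) (by omega)
    have n2 := one_sub_ne hq (n := (N : ℤ) + (N + 1)) (by omega)
    rw [add_sub_cancel_right] at h1 h2
    rw [ih] at h2
    have c1 := qc_step hq ((N : ℤ) + 1 + (N + 1))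
    have c2 := qc_step hq ((N : ℤ) + (N + 1))
    have e1 : (N : ℤ) + 1 + (N + 1) - 1 = N + (N + 1) := by ring
    have e2 : (N : ℤ) + (N + 1) - 1 = 2 * N := by ring
    have e3 : (2 : ℤ) * ((N + 1 : ℕ) : ℤ) = (N : ℤ) + 1 + (N + 1) := by push_cast; ring
    rw [e1] at c1
    rw [e2] at c2
    rw [e3]
    have p1 : q ^ ((N : ℤ) + 1) = q ^ (N + 1) := by
      rw [← zpow_natCast]; push_cast; rfl
    rw [zpow_natCast] at h1
    rw [p1] at h2
    push_cast
    apply mul_left_cancel₀ n1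
    apply mul_left_cancel₀ n2
    rw [h1]
    rw [← c2, ← c1] at h2
    linear_combination (1 - z * q ^ N) * h2

end field
end RR

namespace RR
open Finset
section ps
open PowerSeries

/-- q-factorial in base `X ^ d` -/
noncomputable def Pf (d n : ℕ) : ℚ⟦X⟧ := ∏ i ∈ range n, (1 - (X ^ d) ^ (i + 1))

lemma one_sub_X_pow_const {k : ℕ} (hk : k ≠ 0) : constantCoeff (1 - (X : ℚ⟦X⟧) ^ k) = 1 := by
  simp [hk]

lemma Pf_const {d : ℕ} (hd : d ≠ 0) (n : ℕ) : constantCoeff (Pf d n) = 1 := by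
  rw [Pf, map_prod]
  apply prod_eq_one
  intro i _
  rw [← pow_mul]
  exact one_sub_X_pow_const (by positivity)

/-- inverse q-factorial -/
noncomputable def cps (d : ℕ) (n : ℤ) : ℚ⟦X⟧ := if 0 ≤ n then (Pf d n.toNat)⁻¹ else 0

lemma cps_neg (d : ℕ) {n : ℤ} (h : n < 0) : cps d n = 0 := by simp [cps, not_le.mpr h]

lemma Pf_mul_cps {d : ℕ} (hd : d ≠ 0) (n : ℕ) : Pf d n * cps d n = 1 := by
  simp only [cps, Nat.cast_nonneg, if_true, Int.toNat_natCast]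
  apply PowerSeries.mul_inv_cancel
  rw [Pf_const hd]; exact one_ne_zero

/-- the ambient field -/
abbrev KK := FractionRing ℚ⟦X⟧

/-- the embedding -/
noncomputable abbrev emb : ℚ⟦X⟧ →+* KK := algebraMap _ _

lemma emb_inj : Function.Injective emb := IsFractionRing.injective _ _

lemma emb_cps {d : ℕ} (hd : d ≠ 0) (n : ℤ) : emb (cps d n) = qc (emb X ^ d) n := by
  by_cases h : n < 0
  · rw [cps_neg d h, qc_neg _ h, map_zero]
  obtain ⟨k, rfl⟩ := Int.eq_ofNat_of_zero_le (not_lt.mp h)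
  rw [qc_nat]
  apply eq_inv_of_mul_eq_one_right
  have := congrArg emb (Pf_mul_cps hd k)
  rw [map_mul, map_one, Pf, map_prod] at this
  simpa using this

lemma X_ne : emb X ≠ 0 := by
  rw [Ne, map_eq_zero_iff _ emb_inj]
  exact X_ne_zero

lemma Xd_ne {d : ℕ} (hd : d ≠ 0) (n : ℕ) : (emb X ^ d) ^ (n + 1) ≠ 1 := by
  rw [← pow_mul, ← map_pow]
  intro h
  rw [map_eq_one_iff _ emb_inj] at h
  have := one_sub_X_pow_const (k := d * (n + 1)) (by positivity)
  rw [h] at this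
  simp at this

/-- exponent of the theta series -/
def ee (j : ℤ) : ℕ := (j * (5 * j + 1) / 2).toNat

lemma five_tri (j : ℤ) : j * (5 * j + 1) / 2 = j + j * (j - 1) / 2 + 2 * (j * j) := by
  have : j * (5 * j + 1) = j * (j - 1) + (j + 2 * (j * j)) * 2 := by ring
  rw [this, Int.add_mul_ediv_right _ _ (by norm_num)]; ring

lemma ee_ge (j : ℤ) : j.natAbs ≤ ee j := by
  have h2 : |j| * 2 ≤ j * (5 * j + 1) := by
    rcases le_total 0 j with h | h
    · rw [abs_of_nonneg h]
      by_cases h1 : j = 0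
      · subst h1; norm_num
      · have : 1 ≤ j := by omega
        nlinarith
    · rw [abs_of_nonpos h]
      by_cases h1 : j = 0
      · subst h1; norm_num
      · have : j ≤ -1 := by omega
        nlinarith
  have h3 : |j| ≤ j * (5 * j + 1) / 2 := by omega
  rw [Int.abs_eq_natAbs] at h3
  rw [ee]; omega

lemma ee_cast (j : ℤ) : (ee j : ℤ) = j * (5 * j + 1) / 2 := by
  have h2 : 0 ≤ j * (5 * j + 1) := by
    rcases le_total 0 j with h | h
    · nlinarith
    · by_cases h1 : j = 0
      · subst h1; norm_num
      · have : j ≤ -1 := by omega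
        nlinarith
  rw [ee]; omega

/-- theta series terms -/
noncomputable def th (j : ℤ) : ℚ⟦X⟧ := (-1) ^ j.natAbs * X ^ ee j

lemma emb_th (j : ℤ) : emb (th j) = (-1) ^ j * emb X ^ (j * (5 * j + 1) / 2) := by
  rw [th, map_mul, map_pow, map_pow, ← ee_cast, zpow_natCast, map_neg, map_one]
  congr 1
  rcases Int.natAbs_eq j with h | h
  · conv_rhs => rw [h]
    rw [zpow_natCast]
  · conv_rhs => rw [h]
    rw [zpow_neg, zpow_natCast, ← inv_pow]; norm_num

lemma sum_supp {K : Type*} [Field K] (q : K) (N : ℕ) (g : ℤ → K) :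
    ∑ᶠ j : ℤ, g j * (qc q (N - j) * qc q (N + j)) =
      ∑ j ∈ Icc (-N : ℤ) N, g j * (qc q (N - j) * qc q (N + j)) := by
  apply finsum_eq_sum_of_support_subset
  intro j hj
  rw [Function.mem_support] at hj
  rw [coe_Icc]
  by_contra hc
  apply hj
  simp only [Set.mem_Icc, not_and_or] at hc
  by_cases h4 : (N : ℤ) + j < 0
  · rw [qc_neg q h4]; simp
  · rw [qc_neg q (n := N - j) (by omega)]; simp

lemma ps_RR (N : ℕ) :
    ∑ j ∈ Icc (-N : ℤ) N, th j * (cps 1 (N - j) * cps 1 (N + j)) =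
      ∑ s ∈ range (N + 1), X ^ (s * s) * cps 1 (N - s) * cps 1 s := by
  apply emb_inj
  have h := finite_RR (q := emb X) X_ne (by simpa using Xd_ne one_ne_zero) N
  rw [sum_supp] at h
  rw [map_sum, map_sum]
  have hl : ∀ j : ℤ, emb (th j * (cps 1 (N - j) * cps 1 (N + j))) =
      (-emb X) ^ j * emb X ^ (j * (j - 1) / 2) * emb X ^ (j * j) * emb X ^ (j * j) *
      (qc (emb X) (N - j) * qc (emb X) (N + j)) := by
    intro j
    rw [map_mul, map_mul, emb_cps one_ne_zero, emb_cps one_ne_zero, emb_th, five_tri,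
      zpow_add₀ X_ne, zpow_add₀ X_ne, two_mul, zpow_add₀ X_ne, neg_eq_neg_one_mul (emb X), mul_zpow,
      pow_one]
    ring
  rw [sum_congr rfl fun j _ => hl j, h]
  symm
  apply sum_of_injOn (fun s : ℕ => (s : ℤ))
  · intro a _ b _ h; exact Nat.cast_injective h
  · intro a ha
    simp only [coe_range, Set.mem_Iio] at ha
    simp only [coe_Icc, Set.mem_Icc]
    omega
  · intro s hs hs'
    rw [qc_neg _ (n := s), mul_zero]
    by_contra hc
    apply hs'
    rw [mem_Icc] at hs
    exact ⟨s.toNat, by simp only [coe_range, Set.mem_Iio]; omega, by simp only []; omega⟩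
  · intro s _
    rw [map_mul, map_mul, emb_cps one_ne_zero, emb_cps one_ne_zero, map_pow, pow_one,
      ← zpow_natCast]
    push_cast
    rfl

lemma ps_JTP (N : ℕ) :
    ∑ j ∈ Icc (-N : ℤ) N, th j * (cps 5 (N - j) * cps 5 (N + j)) =
      cps 5 (2 * N) * ∏ i ∈ range N, ((1 - X ^ (5 * i + 3)) * (1 - X ^ (5 * i + 2))) := by
  apply emb_inj
  have h := finite_JTP (q := emb X ^ 5) (z := emb X ^ 3) (pow_ne_zero _ X_ne) (pow_ne_zero _ X_ne)
    (Xd_ne (by norm_num)) N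
  rw [qS, sum_supp] at h
  rw [map_sum, map_mul, map_prod, emb_cps (by norm_num)]
  convert h using 1
  · apply sum_congr rfl
    intro j _
    rw [map_mul, map_mul, emb_cps (by norm_num), emb_cps (by norm_num), emb_th]
    congr 1
    rw [neg_eq_neg_one_mul (emb X ^ 3), mul_zpow, mul_assoc]
    congr 1
    rw [← zpow_natCast, ← zpow_natCast, ← zpow_mul, ← zpow_mul, ← zpow_add₀ X_ne]
    congr 1
    have e : ∃ k, j * (j - 1) = 2 * k := by
      have := Int.even_mul_pred_self j
      obtain ⟨k, hk⟩ := this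
      exact ⟨k, by omega⟩
    obtain ⟨k, hk⟩ := e
    have : j * (5 * j + 1) = 2 * (5 * k + 3 * j) := by linear_combination 5 * hk
    rw [this, hk]
    push_cast
    omega
  · congr 1
    apply prod_congr rfl
    intro i _
    rw [map_mul, map_sub, map_sub, map_one, map_pow, map_pow]
    have hX := X_ne
    congr 2
    · ring
    · field_simp
      ring

/-- quotient by `X ^ M` -/
noncomputable abbrev ph (M : ℕ) : ℚ⟦X⟧ →+* ℚ⟦X⟧ ⧸ Ideal.span {(X : ℚ⟦X⟧) ^ M} := Ideal.Quotient.mk _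

lemma ph_X {M k : ℕ} (h : M ≤ k) : ph M (X ^ k) = 0 := by
  rw [Ideal.Quotient.eq_zero_iff_mem, Ideal.mem_span_singleton]
  exact pow_dvd_pow _ h

lemma ph_coeff {M : ℕ} {f g : ℚ⟦X⟧} (h : ph M f = ph M g) {n : ℕ} (hn : n < M) :
    coeff n f = coeff n g := by
  rw [Ideal.Quotient.eq, Ideal.mem_span_singleton, X_pow_dvd_iff] at h
  have := h n hn
  rwa [map_sub, sub_eq_zero] at this

lemma ph_Pf {M d N : ℕ} (hd : d ≠ 0) (h : M ≤ N) : ph M (Pf d N) = ph M (Pf d M) := by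
  induction N, h using Nat.le_induction with
  | base => rfl
  | succ N h ih =>
    rw [Pf, prod_range_succ, map_mul, ← Pf, ih, map_sub, ← pow_mul, ph_X, map_one, sub_zero,
      mul_one]
    have := Nat.pos_of_ne_zero hd
    nlinarith

lemma ph_cps {M d : ℕ} {N : ℤ} (hd : d ≠ 0) (h : M ≤ N) : ph M (cps d N) = ph M (cps d M) := by
  obtain ⟨N, rfl⟩ := Int.eq_ofNat_of_zero_le (show 0 ≤ N by omega)
  have h1 := congrArg (ph M) (Pf_mul_cps hd N)
  have h2 := congrArg (ph M) (Pf_mul_cps hd M)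
  rw [map_mul, map_one] at h1 h2
  rw [ph_Pf hd (by exact_mod_cast h)] at h1
  linear_combination (ph M (cps d M)) * h1 - (ph M (cps d N)) * h2

lemma th_lim {M d : ℕ} (hd : d ≠ 0) :
    ph M (∑ j ∈ Icc (-(2 * M : ℕ) : ℤ) (2 * M : ℕ), th j *
      (cps d ((2 * M : ℕ) - j) * cps d ((2 * M : ℕ) + j))) =
    ph M (∑ j ∈ Icc (-(2 * M : ℕ) : ℤ) (2 * M : ℕ), th j) * ph M (cps d M) ^ 2 := by
  rw [map_sum, map_sum, sum_mul]
  apply sum_congr rfl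
  intro j _
  rw [map_mul, map_mul]
  by_cases h : M ≤ j.natAbs
  · have : ph M (th j) = 0 := by
      rw [th, map_mul, ph_X (h.trans (ee_ge j)), mul_zero]
    rw [this]; simp
  · rw [ph_cps hd (N := (2 * M : ℕ) - j) (by push_cast; omega),
      ph_cps hd (N := (2 * M : ℕ) + j) (by push_cast; omega), sq]

/-- the Rogers-Ramanujan sum side -/
noncomputable def Rsum (M : ℕ) : ℚ⟦X⟧ := ∑ s ∈ range (2 * M + 1), X ^ (s * s) * cps 1 s

lemma R_lim (M : ℕ) :
    ph M (∑ s ∈ range (2 * M + 1), X ^ (s * s) * cps 1 ((2 * M : ℕ) - s) * cps 1 s) =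
      ph M (Rsum M) * ph M (cps 1 M) := by
  rw [Rsum, map_sum, map_sum, sum_mul]
  apply sum_congr rfl
  intro s _
  rw [map_mul, map_mul, map_mul]
  by_cases h : M ≤ s
  · rw [ph_X (by nlinarith)]; simp
  · rw [ph_cps one_ne_zero (N := (2 * M : ℕ) - s) (by push_cast; omega)]; ring

lemma Pf_split (N : ℕ) : Pf 1 (5 * N) = (∏ i ∈ range N, ((1 - X ^ (5 * i + 1)) *
    (1 - X ^ (5 * i + 4)))) * (∏ i ∈ range N, ((1 - X ^ (5 * i + 3)) * (1 - X ^ (5 * i + 2))))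
    * Pf 5 N := by
  induction N with
  | zero => simp [Pf]
  | succ N ih =>
    simp only [Pf, pow_one] at ih ⊢
    rw [show 5 * (N + 1) = 5 * N + 1 + 1 + 1 + 1 + 1 by ring]
    simp only [prod_range_succ]
    rw [ih]
    ring

theorem main_mod (M : ℕ) :
    ph M (Rsum M) * ph M (∏ i ∈ range (2 * M), ((1 - X ^ (5 * i + 1)) *
    (1 - X ^ (5 * i + 4)))) = 1 := by
  have h1 := congrArg (ph M) (ps_RR (2 * M))
  rw [th_lim one_ne_zero, R_lim] at h1
  have h2 := congrArg (ph M) (ps_JTP (2 * M))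
  rw [th_lim (by norm_num), map_mul, ph_cps (N := 2 * (2 * M : ℕ)) (by norm_num) (by push_cast; omega)] at h2
  have h3 := congrArg (ph M) (Pf_split (2 * M))
  rw [map_mul, map_mul, ph_Pf (N := 5 * (2 * M)) one_ne_zero (by omega),
    ph_Pf (N := 2 * M) (by norm_num) (by omega)] at h3
  have u1 := congrArg (ph M) (Pf_mul_cps one_ne_zero M)
  have u5 := congrArg (ph M) (Pf_mul_cps (d := 5) (by norm_num) M)
  rw [map_mul, map_one] at u1 u5
  generalize ph M (Rsum M) = R at *
  generalize ph M (∑ j ∈ Icc (-(2 * M : ℕ) : ℤ) (2 * M : ℕ), th j) = t at *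
  generalize ph M (cps 1 M) = v at *
  generalize ph M (cps 5 M) = V at *
  generalize ph M (Pf 1 M) = u at *
  generalize ph M (Pf 5 M) = U at *
  generalize ph M (∏ i ∈ range (2 * M), ((1 - X ^ (5 * i + 1)) * (1 - X ^ (5 * i + 4)))) = A at *
  generalize ph M (∏ i ∈ range (2 * M), ((1 - X ^ (5 * i + 3)) * (1 - X ^ (5 * i + 2)))) = B at *
  -- t v = R, t V = B, u = A B U
  have a1 : t * v = R := by linear_combination u * h1 - (t * v - R) * u1
  have a2 : t * V = B := by linear_combination U * h2 - (t * V - B) * u5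
  have a3 : t = B * U := by linear_combination U * a2 - t * u5
  rw [← a1]
  linear_combination u1 - v * h3 + v * A * a3
end ps
end RR

namespace RR
open Finset
section comb
open PowerSeries
open scoped PowerSeries.WithPiTopology

/-- allowed parts -/
abbrev good (a : ℕ) : Prop := a % 5 = 1 ∨ a % 5 = 4

/-- denominators -/
noncomputable def gg (k : ℕ) : ℚ⟦X⟧ := ∏ i ∈ range k, if good (i + 1) then 1 - X ^ (i + 1) else 1

lemma gg_five (N : ℕ) : gg (5 * N) = ∏ i ∈ range N, ((1 - X ^ (5 * i + 1)) *
    (1 - X ^ (5 * i + 4))) := by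
  induction N with
  | zero => simp [gg]
  | succ N ih =>
    rw [prod_range_succ, ← ih]
    simp only [gg]
    rw [show 5 * (N + 1) = 5 * N + 1 + 1 + 1 + 1 + 1 by ring]
    simp only [prod_range_succ]
    rw [if_pos (show good _ by unfold good; omega), if_neg (show ¬ good _ by unfold good; omega),
      if_neg (show ¬ good _ by unfold good; omega), if_pos (show good _ by unfold good; omega),
      if_neg (show ¬ good _ by unfold good; omega)]
    ring

lemma gg_lim {M N : ℕ} (h : M ≤ N) : ph M (gg N) = ph M (gg M) := by
  induction N, h using Nat.le_induction with
  | base => rfl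
  | succ N h ih =>
    rw [gg, prod_range_succ, map_mul, ← gg, ih]
    split_ifs
    · rw [map_sub, ph_X (by omega), map_one, sub_zero, mul_one]
    · rw [map_one, mul_one]

lemma card_good {n M : ℕ} (h : n < M) :
    ((Nat.Partition.restricted n good).card : ℚ) = coeff n (Rsum M) := by
  have h1 := (Nat.Partition.hasProd_powerSeriesMk_card_restricted ℚ good).tendsto_prod_nat
  rw [WithPiTopology.tendsto_iff_coeff_tendsto] at h1
  have h2 := h1 n
  rw [coeff_mk] at h2
  refine tendsto_nhds_unique h2 ?_
  apply tendsto_atTop_of_eventually_const (i₀ := M)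
  intro k hk
  apply ph_coeff (M := M) _ h
  have h3 := main_mod M
  rw [← gg_five, gg_lim (by omega), ← gg_lim hk] at h3
  have h4 : (∏ i ∈ range k, if good (i + 1) then ∑' j : ℕ, (X : ℚ⟦X⟧) ^ ((i + 1) * j) else 1)
      * gg k = 1 := by
    rw [gg, ← prod_mul_distrib]
    apply prod_eq_one
    intro i _
    split_ifs
    · simp_rw [pow_mul]
      exact WithPiTopology.tsum_pow_mul_one_sub_of_constantCoeff_eq_zero (by simp)
    · simp
  have h5 := congrArg (ph M) h4
  rw [map_mul, map_one] at h5
  linear_combination (ph M (Rsum M)) * h5 - (ph M (∏ i ∈ range k, if good (i + 1) then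
    ∑' j : ℕ, (X : ℚ⟦X⟧) ^ ((i + 1) * j) else 1)) * h3

/-- increasing lists with gaps at least two -/
def LL (s n : ℕ) : Set (List ℕ) :=
  {l | l.length = s ∧ l.IsChain (fun a b => a + 2 ≤ b) ∧ (∀ a ∈ l, 0 < a) ∧ l.sum = n}

lemma chain_sorted {l : List ℕ} (h : l.IsChain (fun a b => a + 2 ≤ b)) :
    l.Pairwise (fun a b => a + 2 ≤ b) := by
  have : IsTrans ℕ (fun a b => a + 2 ≤ b) := ⟨fun a b c h1 h2 => by omega⟩
  exact List.isChain_iff_pairwise.mp h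

/-- list to partition -/
def toPart {s n : ℕ} (l : LL s n) : n.Partition :=
  ⟨(l.1 : Multiset ℕ), fun {i} hi => l.2.2.2.1 i (by simpa using hi), by simpa using l.2.2.2.2⟩

lemma sort_coe {l : List ℕ} (h : l.IsChain (fun a b => a + 2 ≤ b)) :
    (l : Multiset ℕ).sort (· ≤ ·) = l := by
  rw [Multiset.coe_sort]
  apply List.mergeSort_of_pairwise
  exact (chain_sorted h).imp (fun h => by simp; omega)

lemma LL_fin (s n : ℕ) : (LL s n).Finite := by
  have : Function.Injective (toPart (s := s) (n := n)) := by
    intro a b h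
    have h2 := congrArg (fun p => p.parts.sort (· ≤ ·)) h
    simp only [toPart] at h2
    rw [sort_coe a.2.2.1, sort_coe b.2.2.1] at h2
    exact Subtype.ext h2
  have := Finite.of_injective _ this
  exact Set.toFinite _

lemma LL_zero (n : ℕ) : (LL 0 n).ncard = if n = 0 then 1 else 0 := by
  split_ifs with h
  · rw [Set.ncard_eq_one]
    refine ⟨[], ?_⟩
    ext l
    simp only [LL, Set.mem_ofPred_eq, List.length_eq_zero_iff, Set.mem_singleton_iff]
    constructor
    · exact fun h => h.1
    · rintro rfl; simp [h]
  · have : LL 0 n = ∅ := by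
      ext l
      simp only [LL, Set.mem_ofPred_eq, List.length_eq_zero_iff, Set.mem_empty_iff_false, iff_false]
      rintro ⟨rfl, -, -, h2⟩
      simp at h2; omega
    simp [this]

lemma sum_map_add (l : List ℕ) (k : ℕ) : (l.map (· + k)).sum = l.sum + k * l.length := by
  induction l with
  | nil => simp
  | cons a l ih => simp [ih]; ring

lemma unmap (l : List ℕ) (k : ℕ) (h : ∀ a ∈ l, k ≤ a) : (l.map (· - k)).map (· + k) = l := by
  rw [List.map_map]
  conv_rhs => rw [← List.map_id l]
  apply List.map_congr_left
  intro a ha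
  have := h a ha
  simp only [Function.comp, id]; omega

lemma chain_map (l : List ℕ) (k : ℕ) : (l.map (· + k)).IsChain (fun a b => a + 2 ≤ b) ↔
    l.IsChain (fun a b => a + 2 ≤ b) := by
  rw [List.isChain_map]
  have : (fun a b => a + k + 2 ≤ b + k) = (fun a b : ℕ => a + 2 ≤ b) := by
    funext a b; apply propext; omega
  rw [this]

lemma map_inj (k : ℕ) : Function.Injective (fun l : List ℕ => l.map (· + k)) := by
  apply List.map_injective_iff.mpr
  intro a b h
  simpa using h

lemma LL_succ (s n : ℕ) : LL (s + 1) n =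
    (if s + 1 ≤ n then Set.image (fun l => l.map (· + 1)) <| LL (s + 1) (n - (s + 1)) else ∅) ∪
    (if 2 * s + 1 ≤ n then Set.image (fun l => 1 :: l.map (· + 2)) <| LL s (n - (2 * s + 1)) else ∅) := by
  ext l
  constructor
  · rintro ⟨h1, h2, h3, h4⟩
    cases l with
    | nil => simp at h1
    | cons a t =>
      have hp := chain_sorted h2
      rw [List.pairwise_cons] at hp
      have ha := h3 a (by simp)
      by_cases h : a = 1
      · right
        subst h
        have hu := unmap t 2 (fun b hb => by have := hp.1 b hb; omega)
        have hs := sum_map_add (t.map (· - 2)) 2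
        rw [hu] at hs
        simp only [List.length_map, List.length_cons, List.sum_cons] at hs h1 h4
        rw [if_pos (by omega)]
        refine ⟨t.map (· - 2), ⟨by simpa using h1, ?_, ?_, by omega⟩, ?_⟩
        · rw [← chain_map _ 2, hu]
          exact h2.tail
        · intro b hb
          rw [List.mem_map] at hb
          obtain ⟨c, hc, rfl⟩ := hb
          have := hp.1 c hc
          omega
        · simp only [hu]
      · left
        have hall : ∀ b ∈ a :: t, 2 ≤ b := by
          intro b hb
          rcases List.mem_cons.mp hb with rfl | hb
          · omega
          · have := hp.1 b hb; omega
        have hu := unmap (a :: t) 1 (fun b hb => by have := hall b hb; omega)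
        have hs := sum_map_add ((a :: t).map (· - 1)) 1
        rw [hu, h4, List.length_map, h1] at hs
        rw [if_pos (by omega)]
        refine ⟨(a :: t).map (· - 1), ⟨by simpa using h1, ?_, ?_, by omega⟩, hu⟩
        · rw [← chain_map _ 1, hu]
          exact h2
        · intro b hb
          rw [List.mem_map] at hb
          obtain ⟨c, hc, rfl⟩ := hb
          have := hall c hc
          omega
  · rintro (h | h)
    · split_ifs at h with hn
      · obtain ⟨l, ⟨h1, h2, h3, h4⟩, rfl⟩ := h
        refine ⟨by simpa using h1, (chain_map _ 1).mpr h2, ?_, ?_⟩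
        · intro b hb
          rw [List.mem_map] at hb
          obtain ⟨c, hc, rfl⟩ := hb
          omega
        · rw [sum_map_add, h4, h1]; omega
      · exact h.elim
    · split_ifs at h with hn
      · obtain ⟨l, ⟨h1, h2, h3, h4⟩, rfl⟩ := h
        refine ⟨by simpa using h1, ?_, ?_, ?_⟩
        · rw [List.isChain_cons]
          refine ⟨?_, (chain_map _ 2).mpr h2⟩
          intro b hb
          have hb := List.mem_of_mem_head? hb
          rw [List.mem_map] at hb
          obtain ⟨c, hc, rfl⟩ := hb
          have := h3 c hc
          omega
        · intro b hb
          rcases List.mem_cons.mp hb with rfl | hb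
          · omega
          · rw [List.mem_map] at hb
            obtain ⟨c, hc, rfl⟩ := hb
            omega
        · rw [List.sum_cons, sum_map_add, h4, h1]; omega
      · exact h.elim

lemma LL_succ_card (s n : ℕ) : (LL (s + 1) n).ncard =
    (if s + 1 ≤ n then (LL (s + 1) (n - (s + 1))).ncard else 0) +
    (if 2 * s + 1 ≤ n then (LL s (n - (2 * s + 1))).ncard else 0) := by
  have f1 : (if s + 1 ≤ n then Set.image (fun l : List ℕ => l.map (· + 1)) <| LL (s + 1) (n - (s + 1))
      else ∅).Finite := by
    split_ifs
    · exact (LL_fin _ _).image _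
    · exact Set.finite_empty
  have f2 : (if 2 * s + 1 ≤ n then Set.image (fun l : List ℕ => 1 :: l.map (· + 2)) <| LL s (n - (2 * s + 1))
      else ∅).Finite := by
    split_ifs
    · exact (LL_fin _ _).image _
    · exact Set.finite_empty
  rw [LL_succ, Set.ncard_union_eq ?_ f1 f2]
  · congr 1
    · split_ifs
      · exact Set.ncard_image_of_injective _ (map_inj 1)
      · simp
    · split_ifs
      · apply Set.ncard_image_of_injective
        intro a b h
        simp only [List.cons.injEq, true_and] at h
        exact map_inj 2 h
      · simp
  · rw [Set.disjoint_left]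
    intro l h1 h2
    split_ifs at h1 h2
    · obtain ⟨a, ha, rfl⟩ := h1
      obtain ⟨b, hb, h⟩ := h2
      cases a with
      | nil => simp at h
      | cons x a =>
        have := ha.2.2.1 x (by simp)
        simp at h
        omega
    all_goals first | exact h1.elim | exact h2.elim

/-- generating function -/
noncomputable def GG (s : ℕ) : ℚ⟦X⟧ := PowerSeries.mk fun n => ((LL s n).ncard : ℚ)

lemma GG_zero : GG 0 = 1 := by
  ext n
  rw [GG, coeff_mk, LL_zero, coeff_one]
  split_ifs <;> simp

lemma GG_succ (s : ℕ) : GG (s + 1) = X ^ (s + 1) * GG (s + 1) + X ^ (2 * s + 1) * GG s := by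
  ext n
  rw [map_add, coeff_X_pow_mul', coeff_X_pow_mul']
  simp only [GG, coeff_mk]
  rw [LL_succ_card]
  push_cast
  rfl

lemma GG_mul (s : ℕ) : GG s * Pf 1 s = X ^ (s * s) := by
  induction s with
  | zero => simp [GG_zero, Pf]
  | succ s ih =>
    have h := GG_succ s
    rw [Pf, prod_range_succ, ← Pf, pow_one]
    rw [show (s + 1) * (s + 1) = s * s + (2 * s + 1) by ring, pow_add _ (s * s), ← ih]
    linear_combination (Pf 1 s) * h

lemma GG_eq (s : ℕ) : GG s = X ^ (s * s) * cps 1 s := by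
  have h1 := GG_mul s
  have h2 := Pf_mul_cps one_ne_zero s
  linear_combination (cps 1 s) * h1 - GG s * h2

lemma coeff_Rsum (M n : ℕ) : coeff n (Rsum M) = ((∑ s ∈ range (2 * M + 1), (LL s n).ncard : ℕ) : ℚ) := by
  rw [Rsum, map_sum]
  push_cast
  apply sum_congr rfl
  intro s _
  rw [← GG_eq, GG, coeff_mk]

/-- all lists -/
def LA (n : ℕ) : Set (List ℕ) :=
  {l | l.IsChain (fun a b => a + 2 ≤ b) ∧ (∀ a ∈ l, 0 < a) ∧ l.sum = n}

/-- partitions with gaps and lists -/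
def partEquiv (n : ℕ) : {p : n.Partition //
      (p.parts.sort (· ≤ ·)).IsChain fun a b => a + 2 ≤ b} ≃ LA n where
  toFun p := ⟨p.1.parts.sort (· ≤ ·), p.2, fun a ha => p.1.parts_pos (by simpa using ha), by
    have h := p.1.parts_sum
    rw [← Multiset.sort_eq p.1.parts (· ≤ ·), Multiset.sum_coe] at h
    exact h⟩
  invFun l := ⟨⟨(l.1 : Multiset ℕ), fun {i} hi => l.2.2.1 i (by simpa using hi),
    by simpa using l.2.2.2⟩, by
      rw [sort_coe l.2.1]; exact l.2.1⟩
  left_inv p := by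
    apply Subtype.ext
    apply Nat.Partition.ext
    simp
  right_inv l := by
    apply Subtype.ext
    exact sort_coe l.2.1

lemma len_le (l : List ℕ) (h : ∀ a ∈ l, 0 < a) : l.length ≤ l.sum := by
  induction l with
  | nil => simp
  | cons a l ih =>
    have h1 := h a (by simp)
    have h2 := ih (fun b hb => h b (by simp [hb]))
    simp only [List.length_cons, List.sum_cons]; omega

lemma LA_card {n M : ℕ} (h : n < M) : Nat.card (LA n) = ∑ s ∈ range (2 * M + 1), (LL s n).ncard := by
  have h1 : LA n = ((range (2 * M + 1)).biUnion fun s => (LL_fin s n).toFinset : Finset (List ℕ)) := by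
    ext l
    simp only [coe_biUnion, Set.Finite.coe_toFinset, Set.mem_iUnion, mem_coe, mem_range]
    constructor
    · rintro ⟨h1, h2, h3⟩
      refine ⟨l.length, ?_, rfl, h1, h2, h3⟩
      have := len_le l h2
      omega
    · rintro ⟨s, _, _, h⟩
      exact h
  rw [h1, Nat.card_coe_set_eq, Set.ncard_coe_finset, card_biUnion]
  · apply sum_congr rfl
    intro s _
    rw [Set.ncard_eq_toFinset_card _ (LL_fin s n)]
  · intro s _ t _ hst
    change Disjoint _ _
    rw [Finset.disjoint_left]
    intro l hl hl'
    rw [Set.Finite.mem_toFinset] at hl hl'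
    exact hst (hl.1.symm.trans hl'.1)

end comb
end RR

/-- first Rogers–Ramanujan identity, combinatorial form.
For every nonnegative integer `n`, the number of partitions of `n` whose parts are all
congruent to `1` or `4` modulo `5` equals the number of partitions of `n` whose
successive parts differ by at least `2` (`b_j − b_{j+1} ≥ 2` in weakly decreasing order;
equivalently, the increasing sorted list of parts satisfies `a + 2 ≤ b` for each pair of
consecutive entries). -/
theorem statement5 (n : ℕ) :
    Nat.card {p : n.Partition // ∀ a ∈ p.parts, a % 5 = 1 ∨ a % 5 = 4} =
    Nat.card {p : n.Partition //
      (p.parts.sort (· ≤ ·)).Chain' fun a b => a + 2 ≤ b} := by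
  have h1 := RR.card_good (Nat.lt_succ_self n)
  rw [RR.coeff_Rsum, Nat.cast_inj, ← RR.LA_card (Nat.lt_succ_self n),
    ← Nat.card_congr (RR.partEquiv n)] at h1
  refine Eq.trans ?_ h1
  rw [Nat.subtype_card]
  intro p
  simp [Nat.Partition.restricted]
end

section
/- Gordon's generalization of the Rogers–Ramanujan identities: let k ≥ i ≥ 1 be integers. For every nonnegative integer n, the number of partitions b₁ ≥ b₂ ≥ ⋯ ≥ b_s of n such that at most i − 1 of the parts equal 1 and b_j − b_{j+k−1} ≥ 2 for all j with 1 ≤ j ≤ s − k + 1, equals the number of partitions of n into parts not congruent to 0, i, or −i modulo 2k + 1. -/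
/-- The Gordon gap condition on a (weakly increasing) sorted list of parts: entries at
distance `k − 1` differ by at least `2`.  For the weakly decreasing enumeration
`b₁ ≥ b₂ ≥ ⋯ ≥ b_s` this says exactly `b_j − b_{j+k−1} ≥ 2` for all
`1 ≤ j ≤ s − k + 1`. -/
def GordonGap (k : ℕ) (l : List ℕ) : Prop :=
  ∀ j : ℕ, j + (k - 1) < l.length → l.getD j 0 + 2 ≤ l.getD (j + (k - 1)) 0

namespace GordonRR
open Finset

/-- Triangular numbers `n (n - 1) / 2`, defined recursively. -/
def tri : ℕ → ℕ
  | 0 => 0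
  | n + 1 => tri n + n

theorem tri_succ (n : ℕ) : tri (n + 1) = tri n + n := rfl

theorem tri_cast (n : ℕ) : 2 * (tri n : ℤ) = n * (n - 1) := by
  induction n with
  | zero => simp [tri]
  | succ n ih => rw [tri_succ]; push_cast; linarith

section ring
variable {A : Type*} [CommRing A]

/-- The finite product `(1 - q) ⋯ (1 - q ^ m)`. -/
def qf (q : A) (m : ℕ) : A := ∏ j ∈ range m, (1 - q ^ (j + 1))

/-- The finite product `(1 - q ^ (n + 1)) ⋯ (1 - q ^ (n + M))`. -/
def qr (q : A) (n M : ℕ) : A := ∏ j ∈ range M, (1 - q ^ (n + 1 + j))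

theorem qf_succ (q : A) (m : ℕ) : qf q (m + 1) = qf q m * (1 - q ^ (m + 1)) := by
  simp [qf, prod_range_succ]

theorem qr_succ (q : A) (n M : ℕ) : qr q n (M + 1) = qr q n M * (1 - q ^ (n + 1 + M)) := by
  simp [qr, prod_range_succ]

theorem qr_succ' (q : A) (n M : ℕ) :
    qr q n (M + 1) = qr q (n + 1) M * (1 - q ^ (n + 1)) := by
  rw [qr, prod_range_succ']
  simp only [qr, add_zero]
  congr 1
  apply prod_congr rfl
  intro j _
  congr 2
  ring

theorem pow_zero_of_le {q : A} {T e : ℕ} (hq : q ^ T = 0) (h : T ≤ e) : q ^ e = 0 :=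
  pow_eq_zero_of_le h hq

theorem qf_stable {q : A} {T m : ℕ} (hq : q ^ T = 0) (h : T ≤ m) : qf q m = qf q T := by
  induction m, h using Nat.le_induction with
  | base => rfl
  | succ m hm ih => rw [qf_succ, ih, pow_zero_of_le hq (by omega)]; simp

theorem qf_unit {q : A} {T : ℕ} (hq : q ^ T = 0) (m : ℕ) : IsUnit (qf q m) := by
  induction m with
  | zero => simp [qf]
  | succ m ih =>
    rw [qf_succ]
    refine ih.mul ?_
    apply IsNilpotent.isUnit_one_sub
    exact IsNilpotent.pow_succ m ⟨T, hq⟩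

/-- The alternating sum (times `(q)_∞`). -/
def S (q : A) (k B i M : ℕ) : A :=
  ∑ n ∈ range B, (-1) ^ n * q ^ (M * k * n + (2 * k + 1) * tri n + (2 * k + 1 - i) * n) *
    (1 - q ^ ((2 * n + 1 + M) * i)) * qr q n M

theorem S_zero (q : A) (k B M : ℕ) : S q k B 0 M = 0 := by simp [S]

theorem S_rec {q : A} {T B : ℕ} (hq : q ^ T = 0) (hB : T ≤ B) (a c M : ℕ) (hc : 1 ≤ c) :
    S q (a + c) B (a + 1) M = S q (a + c) B a M +
      q ^ ((M + 1) * a) * S q (a + c) B c (M + 1) := by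
  have e1 : 2 * (a + c) + 1 - (a + 1) = a + 2 * c := by omega
  have e2 : 2 * (a + c) + 1 - a = a + 2 * c + 1 := by omega
  have e3 : 2 * (a + c) + 1 - c = 2 * a + c + 1 := by omega
  simp only [S, e1, e2, e3]
  let u : ℕ → A := fun n =>
    (-1) ^ n * q ^ (M * (a + c) * n + (2 * (a + c) + 1) * tri n + (a + 2 * c) * n) *
      (1 - q ^ n) * qr q n M
  have hu0 : u 0 = 0 := by simp [u]
  have huB : u B = 0 := by
    simp only [u]
    rw [pow_zero_of_le hq (e := M * (a + c) * B + (2 * (a + c) + 1) * tri B + (a + 2 * c) * B)]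
    · simp
    · nlinarith [Nat.zero_le (M * (a + c) * B), Nat.zero_le ((2 * (a + c) + 1) * tri B),
        Nat.zero_le (a * B), Nat.mul_le_mul hc (le_refl B)]
  have htel := Finset.sum_range_sub' u B
  rw [hu0, huB, sub_zero] at htel
  rw [mul_sum, ← sub_eq_zero, ← htel, ← sum_add_distrib, ← sum_sub_distrib, ← sub_eq_zero,
    ← sum_sub_distrib]
  apply sum_eq_zero
  intro n _
  simp only [u]
  have h1 := qr_succ q n M
  have h2 : qr q (n + 1) M * (1 - q ^ (n + 1)) = qr q n M * (1 - q ^ (n + 1 + M)) := by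
    rw [← qr_succ, ← qr_succ']
  rw [mul_assoc _ (1 - q ^ (n + 1)), mul_comm (1 - q ^ (n + 1)), h2, h1, tri_succ]
  ring

theorem S_top {q : A} {T B : ℕ} (hq : q ^ T = 0) (hB : 1 ≤ B) (k i M : ℕ) (hi : 1 ≤ i)
    (hik : i ≤ k) (hM : T ≤ M) : S q k B i M = qf q M := by
  rw [S, Finset.sum_eq_single_of_mem 0 (mem_range.2 hB)]
  · rw [pow_zero_of_le hq (e := (2 * 0 + 1 + M) * i) (by nlinarith)]
    simp [tri, qr, qf, add_comm]
  · intro n _ hn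
    rw [pow_zero_of_le hq (e := M * k * n + (2 * k + 1) * tri n + (2 * k + 1 - i) * n)]
    · simp
    · have : M * 1 ≤ M * (k * n) := Nat.mul_le_mul_left _ (Nat.mul_pos (by omega) (by omega))
      rw [← mul_assoc] at this
      omega

end ring
section jtp
variable {A : Type*} [CommRing A]

/-- Gaussian binomial coefficients. -/
def gb (Q : A) : ℕ → ℕ → A
  | _, 0 => 1
  | 0, _ + 1 => 0
  | n + 1, k + 1 => gb Q n k + Q ^ (k + 1) * gb Q n (k + 1)

theorem gb_zero (Q : A) (n : ℕ) : gb Q n 0 = 1 := by cases n <;> rfl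

theorem gb_gt (Q : A) (n k : ℕ) (h : n < k) : gb Q n k = 0 := by
  induction n generalizing k with
  | zero => cases k with
    | zero => omega
    | succ k => rfl
  | succ n ih => cases k with
    | zero => omega
    | succ k => simp [gb, ih k (by omega), ih (k + 1) (by omega)]

theorem gb_fac (Q : A) (a b : ℕ) : qf Q a * qf Q b * gb Q (a + b) a = qf Q (a + b) := by
  induction hs : a + b generalizing a b with
  | zero =>
    obtain rfl : a = 0 := by omega
    obtain rfl : b = 0 := by omega
    simp [qf, gb]
  | succ s ih =>
    rcases a with _ | a
    · obtain rfl : b = s + 1 := by omega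
      simp [gb_zero, qf]
    · rcases b with _ | b
      · obtain rfl : a = s := by omega
        have := ih a 0 (by omega)
        simp only [gb, gb_gt Q a (a+1) (by omega)]
        rw [qf_succ]
        linear_combination (1 - Q ^ (a + 1)) * this
      · have h1 := ih a (b + 1) (by omega)
        have h2 := ih (a + 1) b (by omega)
        simp only [gb]
        obtain rfl : s = a + b + 1 := by omega
        have : qf Q (a + b + 1 + 1) = (1 - Q ^ (a + 1)) * qf Q (a + b + 1) +
          Q ^ (a + 1) * (1 - Q ^ (b + 1)) * qf Q (a + b + 1) := by
          rw [qf_succ Q (a + b + 1)]; ring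
        rw [this]
        nth_rewrite 1 [← h1]
        rw [← h2, qf_succ Q a, qf_succ Q b]
        ring

theorem qbinom (Q a b : A) (n : ℕ) :
    ∏ j ∈ range n, (a + b * Q ^ j) =
      ∑ j ∈ range (n + 1), Q ^ tri j * gb Q n j * a ^ (n - j) * b ^ j := by
  induction n generalizing a b with
  | zero => simp [gb, tri]
  | succ n ih =>
    have : ∏ j ∈ range (n + 1), (a + b * Q ^ j) =
        (∏ j ∈ range n, (a + (b * Q) * Q ^ j)) * (a + b) := by
      rw [prod_range_succ']
      simp only [pow_zero, mul_one]
      congr 1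
      apply prod_congr rfl
      intro j _
      ring
    rw [this, ih]
    rw [mul_add, sum_mul, sum_mul, Finset.sum_range_succ']
    rw [Finset.sum_range_succ' _ (n + 1)]
    have h3 : ∑ j ∈ range (n + 1), Q ^ tri (j + 1) * gb Q (n + 1) (j + 1) *
        a ^ (n + 1 - (j + 1)) * b ^ (j + 1) =
        ∑ j ∈ range (n + 1), Q ^ tri (j + 1) * gb Q n (j + 1) * Q ^ (j + 1) *
        a ^ (n - j) * b ^ (j + 1) +
        ∑ j ∈ range (n + 1), Q ^ tri j * gb Q n j * a ^ (n - j) * (b * Q) ^ j * b := by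
      rw [← sum_add_distrib]
      apply sum_congr rfl
      intro j _
      rw [Nat.add_sub_add_right, gb, tri_succ]
      ring
    rw [h3, Finset.sum_range_succ (fun j => Q ^ tri (j + 1) * gb Q n (j + 1) * Q ^ (j + 1) *
        a ^ (n - j) * b ^ (j + 1)) n, gb_gt Q n (n + 1) (by omega)]
    have h4 : ∑ j ∈ range n, Q ^ tri (j + 1) * gb Q n (j + 1) * a ^ (n - (j + 1)) *
        (b * Q) ^ (j + 1) * a = ∑ j ∈ range n, Q ^ tri (j + 1) * gb Q n (j + 1) * Q ^ (j + 1) *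
        a ^ (n - j) * b ^ (j + 1) := by
      apply sum_congr rfl
      intro j hj
      have : n - j = n - (j + 1) + 1 := by have := mem_range.1 hj; omega
      rw [this]
      ring
    rw [h4]
    simp only [gb_zero, tri]
    simp only [Nat.sub_zero, pow_succ a n]
    ring

theorem gb_map {A' : Type*} [CommRing A'] (f : A →+* A') (Q : A) (n k : ℕ) :
    f (gb Q n k) = gb (f Q) n k := by
  induction n generalizing k with
  | zero => cases k <;> simp [gb]
  | succ n ih => cases k <;> simp [gb, ih]

theorem tri_add (a b : ℕ) : tri (a + b) = tri a + tri b + a * b := by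
  induction b with
  | zero => simp [tri]
  | succ b ih => rw [← add_assoc, tri_succ, ih, tri_succ]; ring

theorem two_tri (n : ℕ) : 2 * tri (n + 1) = (n + 1) * n := by
  induction n with
  | zero => simp [tri]
  | succ n ih => rw [tri_succ, mul_add, ih]; ring

theorem prod_pow_range (Q : A) (L : ℕ) : ∏ j ∈ range L, Q ^ j = Q ^ tri L := by
  induction L with
  | zero => simp [tri]
  | succ n ih => rw [prod_range_succ, ih, tri_succ, pow_add]

/-- Finite form of the Jacobi triple product, multiplied by a power of `q`. -/
theorem fjtp_aux (q : A) (i i' l : ℕ) :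
    q ^ ((i + i') * tri (l + 1) + ((i + i') * l + i) * (l + 1)) *
      ((∏ j ∈ range (l + 1), (1 - q ^ ((i + i') * j + i))) *
        ∏ j ∈ range (l + 1), (1 - q ^ ((i + i') * j + i'))) =
    q ^ ((i + i') * tri (l + 1) + ((i + i') * l + i) * (l + 1)) *
      (∑ n ∈ range (l + 1), (-1) ^ (n + 1) * q ^ ((i + i') * tri (n + 1) + i * (n + 1)) *
          gb (q ^ (i + i')) (l + 1 + (l + 1)) (l - n) +
       ∑ n ∈ range (l + 2), (-1) ^ n * q ^ ((i + i') * tri n + i' * n) *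
          gb (q ^ (i + i')) (l + 1 + (l + 1)) (l + 1 + n)) := by
  have h := qbinom (q ^ (i + i')) (q ^ ((i + i') * l + i)) (-1) (l + 1 + (l + 1))
  rw [prod_range_add, ← prod_range_reflect] at h
  have hL1 : ∏ j ∈ range (l + 1), (q ^ ((i + i') * l + i) + -1 * (q ^ (i + i')) ^ (l + 1 - 1 - j))
      = (-1) ^ (l + 1) * q ^ ((i + i') * tri (l + 1)) *
        ∏ j ∈ range (l + 1), (1 - q ^ ((i + i') * j + i)) := by
    have : q ^ ((i + i') * tri (l + 1)) =
        ∏ j ∈ range (l + 1), (q ^ (i + i')) ^ (l + 1 - 1 - j) := by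
      rw [pow_mul, ← prod_pow_range, prod_range_reflect]
    rw [this]
    have h1 : (-1 : A) ^ (l + 1) = ∏ j ∈ range (l + 1), (-1 : A) := by simp
    rw [h1, ← prod_mul_distrib, ← prod_mul_distrib]
    apply prod_congr rfl
    intro j hj
    obtain ⟨m, rfl⟩ : ∃ m, l = j + m := ⟨l - j, by have := mem_range.1 hj; omega⟩
    have : j + m + 1 - 1 - j = m := by omega
    rw [this]
    ring
  have hL2 : ∏ j ∈ range (l + 1), (q ^ ((i + i') * l + i) +
      -1 * (q ^ (i + i')) ^ (l + 1 + j))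
      = q ^ (((i + i') * l + i) * (l + 1)) *
        ∏ j ∈ range (l + 1), (1 - q ^ ((i + i') * j + i')) := by
    rw [pow_mul]
    have h1 : ((q ^ ((i + i') * l + i)) ^ (l + 1) : A) =
      ∏ j ∈ range (l + 1), (q ^ ((i + i') * l + i)) := by simp
    rw [h1, ← prod_mul_distrib]
    apply prod_congr rfl
    intro j hj
    ring
  rw [hL1, hL2, show l + 1 + (l + 1) + 1 = (l + 1) + (l + 2) by ring,
    sum_range_add, ← sum_range_reflect] at h
  have key : ∀ x y : A, (-1) ^ (l + 1) * x = (-1) ^ (l + 1) * y → x = y := by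
    intro x y hxy
    have := congrArg (fun z => (-1) ^ (l + 1) * z) hxy
    simpa [← mul_assoc, ← pow_add, ← two_mul] using this
  apply key
  have h' : ∀ z w P R : A, z * (q ^ ((i + i') * tri (l + 1) +
    ((i + i') * l + i) * (l + 1)) * (P * R)) =
    (z * q ^ ((i + i') * tri (l + 1)) * P) * (q ^ (((i + i') * l + i) * (l + 1)) * R) := by
    intro z w P R
    rw [pow_add]; ring
  rw [h' _ 0, h, mul_add, mul_add, mul_sum, mul_sum, mul_sum, mul_sum]
  congr 1
  · apply sum_congr rfl
    intro n hn
    obtain ⟨m, rfl⟩ : ∃ m, l = n + m := ⟨l - n, by have := mem_range.1 hn; omega⟩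
    have e1 : n + m + 1 - 1 - n = m := by omega
    have e2 : n + m - n = m := by omega
    have e3 : n + m + 1 + (n + m + 1) - m = n + m + 1 + n + 1 := by omega
    rw [e1, e2, e3]
    have e4 : (i + i') * tri m + ((i + i') * (n + m) + i) * (n + m + 1 + n + 1) =
      (i + i') * tri (n + m + 1) + ((i + i') * (n + m) + i) * (n + m + 1) +
      ((i + i') * tri (n + 1) + i * (n + 1)) := by
      have h1 := tri_add m (n + 1)
      have h2 := two_tri n
      rw [show n + m + 1 = m + (n + 1) by ring, h1]
      zify at h2 ⊢
      linear_combination -(i + i' : ℤ) * h2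
    have s : (-1 : A) ^ m = (-1) ^ (n + m + 1) * (-1) ^ (n + 1) := by
      rw [← pow_add, show n + m + 1 + (n + 1) = m + 2 * (n + 1) by ring, pow_add, pow_mul]
      simp
    rw [s, ← pow_mul, ← pow_mul]
    have e5 := congrArg (fun e => q ^ e) e4
    simp only [pow_add q ((i + i') * tri m), pow_add q ((i + i') * tri (n + m + 1) + _)] at e5
    linear_combination ((-1) ^ (n + m + 1) * (-1) ^ (n + 1) *
      gb (q ^ (i + i')) (n + m + 1 + (n + m + 1)) m) * e5
  · apply sum_congr rfl
    intro n hn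
    obtain ⟨m, hm⟩ : ∃ m, l + 1 = n + m := ⟨l + 1 - n, by have := mem_range.1 hn; omega⟩
    have e3 : l + 1 + (l + 1) - (l + 1 + n) = m := by omega
    rw [e3]
    have e4 : (i + i') * tri (l + 1 + n) + ((i + i') * l + i) * m =
      (i + i') * tri (l + 1) + ((i + i') * l + i) * (l + 1) +
      ((i + i') * tri n + i' * n) := by
      have h1 := tri_add (l + 1) n
      rw [h1]
      zify at hm ⊢
      linear_combination -((i + i') * l + i : ℤ) * hm
    rw [← pow_mul, ← pow_mul]
    have e5 := congrArg (fun e => q ^ e) e4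
    simp only [pow_add q ((i + i') * tri (l + 1 + n)),
      pow_add q ((i + i') * tri (l + 1) + _)] at e5
    rw [pow_add (-1 : A) (l + 1) n]
    linear_combination ((-1) ^ (l + 1) * (-1) ^ n *
      gb (q ^ (i + i')) (l + 1 + (l + 1)) (l + 1 + n)) * e5

/-- Finite form of the Jacobi triple product. -/
theorem fjtp (q : A) (i i' l : ℕ) :
      (∏ j ∈ range (l + 1), (1 - q ^ ((i + i') * j + i))) *
        ∏ j ∈ range (l + 1), (1 - q ^ ((i + i') * j + i')) =
      ∑ n ∈ range (l + 1), (-1) ^ (n + 1) * q ^ ((i + i') * tri (n + 1) + i * (n + 1)) *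
          gb (q ^ (i + i')) (l + 1 + (l + 1)) (l - n) +
       ∑ n ∈ range (l + 2), (-1) ^ n * q ^ ((i + i') * tri n + i' * n) *
          gb (q ^ (i + i')) (l + 1 + (l + 1)) (l + 1 + n) := by
  have h := fjtp_aux (Polynomial.X : Polynomial ℤ) i i' l
  have h := mul_left_cancel₀ (pow_ne_zero _ Polynomial.X_ne_zero) h
  have h := congrArg (Polynomial.aeval q).toRingHom h
  simp only [map_mul, map_add, map_prod, map_sum, map_sub, map_pow, map_one, map_neg,
    gb_map] at h
  simpa using h

/-- Jacobi triple product modulo `q ^ T`. -/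
theorem jtp {q : A} {T : ℕ} (hq : q ^ T = 0) (i i' l B : ℕ) (hi : 1 ≤ i) (hi' : 1 ≤ i')
    (hl : 2 * T ≤ l) (hB : T ≤ B) :
      qf (q ^ (i + i')) (l + 1) * ((∏ j ∈ range (l + 1), (1 - q ^ ((i + i') * j + i))) *
        ∏ j ∈ range (l + 1), (1 - q ^ ((i + i') * j + i'))) =
      ∑ n ∈ range B, ((-1) ^ (n + 1) * q ^ ((i + i') * tri (n + 1) + i * (n + 1)) +
        (-1) ^ n * q ^ ((i + i') * tri n + i' * n)) := by
  have hQ : (q ^ (i + i')) ^ T = 0 := by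
    rw [← pow_mul, mul_comm, pow_mul, hq, zero_pow (by omega)]
  have hg : ∀ a b, T ≤ a → T ≤ b →
      qf (q ^ (i + i')) (l + 1) * gb (q ^ (i + i')) (a + b) a = 1 := by
    intro a b ha hb
    have h := gb_fac (q ^ (i + i')) a b
    rw [qf_stable hQ ha, qf_stable hQ hb, qf_stable hQ (show T ≤ a + b by omega)] at h
    rw [qf_stable hQ (show T ≤ l + 1 by omega)]
    apply (qf_unit hQ T).mul_left_cancel
    rw [← mul_assoc, h, mul_one]
  have hz1 : ∀ n, T ≤ n → q ^ ((i + i') * tri (n + 1) + i * (n + 1)) = 0 := by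
    intro n hn
    apply pow_zero_of_le hq
    nlinarith [Nat.zero_le ((i + i') * tri (n + 1))]
  have hz2 : ∀ n, T ≤ n → q ^ ((i + i') * tri n + i' * n) = 0 := by
    intro n hn
    apply pow_zero_of_le hq
    nlinarith [Nat.zero_le ((i + i') * tri n)]
  have trunc : ∀ (f : ℕ → A) (C : ℕ), T ≤ C → (∀ n, T ≤ n → f n = 0) →
      ∑ n ∈ range C, f n = ∑ n ∈ range T, f n := by
    intro f C hC hf
    symm
    apply sum_subset (range_subset_range.2 hC)
    intro n _ hn
    exact hf n (by simpa using hn)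
  rw [fjtp, mul_add, mul_sum, mul_sum, sum_add_distrib]
  congr 1
  · rw [trunc _ _ (show T ≤ l + 1 by omega), trunc _ B hB]
    · apply sum_congr rfl
      intro n hn
      have hn := mem_range.1 hn
      have := hg (l - n) (l + 1 + n + 1) (by omega) (by omega)
      rw [show l - n + (l + 1 + n + 1) = l + 1 + (l + 1) by omega] at this
      linear_combination ((-1) ^ (n + 1) * q ^ ((i + i') * tri (n + 1) + i * (n + 1))) * this
    · intro n hn; rw [hz1 n hn]; simp
    · intro n hn; rw [hz1 n hn]; simp
  · rw [trunc _ _ (show T ≤ l + 2 by omega), trunc _ B hB]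
    · apply sum_congr rfl
      intro n hn
      have hn := mem_range.1 hn
      have := hg (l + 1 + n) (l + 1 - n) (by omega) (by omega)
      rw [show l + 1 + n + (l + 1 - n) = l + 1 + (l + 1) by omega] at this
      linear_combination ((-1) ^ n * q ^ ((i + i') * tri n + i' * n)) * this
    · intro n hn; rw [hz2 n hn]; simp
    · intro n hn; rw [hz2 n hn]; simp

/-- The sum at `M = 0` as a product. -/
theorem S_eq_prod {q : A} {T B k i l : ℕ} (hq : q ^ T = 0) (hi : 1 ≤ i) (hik : i ≤ k)
    (hl : 2 * T ≤ l) (hB : T ≤ B) :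
    S q k B i 0 = qf (q ^ (2 * k + 1)) (l + 1) *
      ((∏ j ∈ range (l + 1), (1 - q ^ ((2 * k + 1) * j + i))) *
        ∏ j ∈ range (l + 1), (1 - q ^ ((2 * k + 1) * j + (2 * k + 1 - i)))) := by
  obtain ⟨i', hi'⟩ : ∃ i', 2 * k + 1 = i + i' := ⟨2 * k + 1 - i, by omega⟩
  rw [S, hi', show i + i' - i = i' by omega, jtp hq i i' l B hi (by omega) hl hB]
  apply sum_congr rfl
  intro n _
  simp only [qr, range_zero, prod_empty, tri_succ]
  have h2 : (i + i') * tri n + i' * n + (2 * n + 1) * i = (i + i') * (tri n + n) + i * (n + 1) := by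
    ring
  rw [← h2, pow_add q _ ((2 * n + 1) * i)]
  ring_nf

end jtp

section comb
open scoped Classical in
/-- All multisets of positive integers with sum less than `T`. -/
noncomputable def U (T : ℕ) : Finset (Multiset ℕ) :=
  (range T).biUnion fun n => (univ : Finset n.Partition).image Nat.Partition.parts

theorem mem_U {T : ℕ} {s : Multiset ℕ} : s ∈ U T ↔ s.sum < T ∧ ∀ a ∈ s, 0 < a := by
  simp only [U, mem_biUnion, mem_range, mem_image, mem_univ, true_and]
  constructor
  · rintro ⟨n, hn, p, rfl⟩
    exact ⟨by rw [p.parts_sum]; exact hn, fun a ha => p.parts_pos ha⟩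
  · rintro ⟨h1, h2⟩
    exact ⟨s.sum, h1, ⟨s, fun {a} ha => h2 a ha, rfl⟩, rfl⟩

variable {A : Type*} [CommRing A]

open scoped Classical in
/-- Generating function (truncated at `T`) of a class of multisets of positive integers. -/
noncomputable def gf (q : A) (T : ℕ) (P : Multiset ℕ → Prop) : A :=
  ∑ s ∈ (U T).filter P, q ^ s.sum

theorem gf_congr (q : A) (T : ℕ) {P P' : Multiset ℕ → Prop}
    (h : ∀ s, (∀ a ∈ s, 0 < a) → (P s ↔ P' s)) : gf q T P = gf q T P' := by
  unfold gf
  congr 1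
  ext s
  simp only [mem_filter, mem_U]
  constructor
  · rintro ⟨h1, h2⟩; exact ⟨h1, (h s h1.2).1 h2⟩
  · rintro ⟨h1, h2⟩; exact ⟨h1, (h s h1.2).2 h2⟩

theorem gf_split (q : A) (T : ℕ) (P R : Multiset ℕ → Prop) :
    gf q T P = gf q T (fun s => P s ∧ R s) + gf q T (fun s => P s ∧ ¬ R s) := by
  classical
  unfold gf
  rw [← sum_filter_add_sum_filter_not ((U T).filter P) R, filter_filter, filter_filter]
  congr!

theorem gf_shift {q : A} {T : ℕ} (hq : q ^ T = 0) (r : Multiset ℕ) (hr : ∀ a ∈ r, 0 < a)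
    {P P' : Multiset ℕ → Prop} (h1 : ∀ t, P' t → P (r + t))
    (h2 : ∀ s, P s → r ≤ s ∧ P' (s - r)) : gf q T P = q ^ r.sum * gf q T P' := by
  classical
  unfold gf
  rw [mul_sum]
  symm
  apply Finset.sum_bij_ne_zero (fun t _ _ => r + t)
  · intro t ht hne
    simp only [mem_filter, mem_U] at ht ⊢
    refine ⟨⟨?_, ?_⟩, h1 t ht.2⟩
    · by_contra hlt
      apply hne
      rw [← pow_add, ← Multiset.sum_add]
      exact pow_zero_of_le hq (by omega)
    · intro a ha
      rcases Multiset.mem_add.1 ha with h | h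
      · exact hr a h
      · exact ht.1.2 a h
  · intro t _ _ t' _ _ h
    exact add_left_cancel h
  · intro s hs hne
    simp only [mem_filter, mem_U] at hs
    obtain ⟨h3, h4⟩ := h2 s hs.2
    have h5 : r + (s - r) = s := add_tsub_cancel_of_le h3
    have h6 : r.sum + (s - r).sum = s.sum := by rw [← Multiset.sum_add, h5]
    refine ⟨s - r, ?_, ?_, h5⟩
    · simp only [mem_filter, mem_U]
      exact ⟨⟨by omega, fun a ha => hs.1.2 a (Multiset.mem_of_le (Multiset.sub_le_self s r) ha)⟩, h4⟩
    · rw [← pow_add, h6]; exact hne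
  · intro t _ _
    rw [Multiset.sum_add, pow_add]

theorem gf_one {q : A} {T : ℕ} (hq : q ^ T = 0) {P : Multiset ℕ → Prop} (h0 : P 0)
    (h : ∀ s, P s → ∀ a ∈ s, T ≤ a) : gf q T P = 1 := by
  classical
  rcases Nat.eq_zero_or_pos T with rfl | hT
  · have : Subsingleton A := by
      rw [← subsingleton_iff_zero_eq_one, ← hq, pow_zero]
    exact Subsingleton.elim _ _
  · unfold gf
    rw [Finset.sum_eq_single_of_mem (0 : Multiset ℕ)]
    · simp
    · simp [mem_U, h0, hT]
    · intro s hs hne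
      simp only [mem_filter, mem_U] at hs
      obtain ⟨a, ha⟩ := Multiset.exists_mem_of_ne_zero hne
      have := h s hs.2 a ha
      have := Multiset.single_le_sum (fun x _ => Nat.zero_le x) a ha
      omega

theorem gf_false (q : A) (T : ℕ) {P : Multiset ℕ → Prop} (h : ∀ s, ¬ P s) : gf q T P = 0 := by
  classical
  unfold gf
  rw [Finset.filter_false_of_mem (fun s _ => h s), sum_empty]

/-- The Gordon condition in terms of multiplicities, with all parts larger than `M`. -/
def Gp (k i M : ℕ) (s : Multiset ℕ) : Prop :=
  (∀ a ∈ s, M + 1 ≤ a) ∧ s.count (M + 1) < i ∧ ∀ j, s.count j + s.count (j + 1) < k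

theorem G_rec {q : A} {T : ℕ} (hq : q ^ T = 0) (a c M : ℕ) (hc : 1 ≤ c) :
    gf q T (Gp (a + c) (a + 1) M) = gf q T (Gp (a + c) a M) +
      q ^ ((M + 1) * a) * gf q T (Gp (a + c) c (M + 1)) := by
  rw [gf_split q T (Gp (a + c) (a + 1) M) (fun s => s.count (M + 1) < a)]
  congr 1
  · apply gf_congr
    intro s _
    simp only [Gp]
    constructor
    · rintro ⟨⟨h1, h2, h3⟩, h4⟩; exact ⟨h1, h4, h3⟩
    · rintro ⟨h1, h2, h3⟩; exact ⟨⟨h1, by omega, h3⟩, h2⟩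
  · rw [gf_shift hq (Multiset.replicate a (M + 1))]
    · rw [Multiset.sum_replicate, smul_eq_mul, mul_comm a]
    · intro x hx
      rw [Multiset.eq_of_mem_replicate hx]; omega
    · rintro t ⟨h1, h2, h3⟩
      have hc1 : t.count (M + 1) = 0 := by
        rw [Multiset.count_eq_zero]; intro hm; have := h1 _ hm; omega
      have hc0 : t.count M = 0 := by
        rw [Multiset.count_eq_zero]; intro hm; have := h1 _ hm; omega
      refine ⟨⟨?_, ?_, ?_⟩, ?_⟩
      · intro x hx
        rcases Multiset.mem_add.1 hx with h | h
        · rw [Multiset.eq_of_mem_replicate h]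
        · have := h1 x h; omega
      · rw [Multiset.count_add, Multiset.count_replicate_self]; omega
      · intro j
        simp only [Multiset.count_add, Multiset.count_replicate]
        have := h3 j
        rcases eq_or_ne j M with rfl | hj
        · simp; omega
        · rcases eq_or_ne j (M + 1) with rfl | hj1
          · simp; omega
          · rw [if_neg (by omega), if_neg (by omega)]; omega
      · rw [Multiset.count_add, Multiset.count_replicate_self]; omega
    · rintro s ⟨⟨h1, h2, h3⟩, h4⟩
      have hca : s.count (M + 1) = a := by omega
      refine ⟨Multiset.le_count_iff_replicate_le.1 (by omega), ?_, ?_, ?_⟩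
      · intro x hx
        have hx' := h1 x (Multiset.mem_of_le (Multiset.sub_le_self _ _) hx)
        have : x ≠ M + 1 := by
          rintro rfl
          have := Multiset.count_pos.2 hx
          rw [Multiset.count_sub, Multiset.count_replicate_self] at this
          omega
        omega
      · have := h3 (M + 1)
        rw [Multiset.count_sub]
        omega
      · intro j
        have := h3 j
        simp only [Multiset.count_sub]
        omega

theorem G_main {q : A} {T B k : ℕ} (hq : q ^ T = 0) (hB : T ≤ B) (hB1 : 1 ≤ B) (W : ℕ)
    (hW : T ≤ W) (d M : ℕ) (hd : d + M = W) (i : ℕ) (hik : i ≤ k) :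
    qf q W * gf q T (Gp k i M) = S q k B i M := by
  induction d generalizing M i with
  | zero =>
    obtain rfl : M = W := by omega
    rcases Nat.eq_zero_or_pos i with rfl | hi
    · rw [S_zero, gf_false, mul_zero]
      rintro s ⟨_, h, _⟩; omega
    · rw [S_top hq hB1 k i M hi hik hW, gf_one hq, mul_one]
      · exact ⟨by simp, by simpa using hi, by simp; omega⟩
      · rintro s ⟨h, _⟩ a ha
        have := h a ha; omega
  | succ d ihd =>
    induction i with
    | zero =>
      rw [S_zero, gf_false, mul_zero]
      rintro s ⟨_, h, _⟩; omega
    | succ a iha =>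
      obtain ⟨c, rfl⟩ : ∃ c, k = a + c := ⟨k - a, by omega⟩
      rw [S_rec hq hB a c M (by omega), G_rec hq a c M (by omega), ← iha (by omega),
        ← ihd (M + 1) (by omega) c (by omega)]
      ring

/-- All parts are larger than `M` and allowed. -/
def Hp (al : ℕ → Prop) (M : ℕ) (s : Multiset ℕ) : Prop := ∀ a ∈ s, M + 1 ≤ a ∧ al a

open scoped Classical in
theorem H_rec {q : A} {T : ℕ} (hq : q ^ T = 0) (al : ℕ → Prop) (M : ℕ) :
    (if al (M + 1) then 1 - q ^ (M + 1) else 1) * gf q T (Hp al M) = gf q T (Hp al (M + 1)) := by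
  split_ifs with h
  · have h0 := gf_split q T (Hp al M) (fun s => M + 1 ∈ s)
    have h1 : gf q T (fun s => Hp al M s ∧ M + 1 ∈ s) = q ^ (M + 1) * gf q T (Hp al M) := by
      rw [gf_shift hq {M + 1} (P' := Hp al M)]
      · simp
      · simp
      · intro t ht
        refine ⟨?_, by simp⟩
        intro a ha
        rcases Multiset.mem_add.1 ha with h' | h'
        · rw [Multiset.mem_singleton.1 h']; exact ⟨le_refl _, h⟩
        · exact ht a h'
      · rintro s ⟨h1, h2⟩
        exact ⟨Multiset.singleton_le.2 h2,
          fun a ha => h1 a (Multiset.mem_of_le (Multiset.sub_le_self _ _) ha)⟩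
    have h2 : gf q T (fun s => Hp al M s ∧ M + 1 ∉ s) = gf q T (Hp al (M + 1)) := by
      apply gf_congr
      intro s _
      constructor
      · rintro ⟨h1, h2⟩ a ha
        have : a ≠ M + 1 := by rintro rfl; exact h2 ha
        have := h1 a ha
        exact ⟨by omega, this.2⟩
      · intro h1
        refine ⟨fun a ha => ⟨by have := h1 a ha; omega, (h1 a ha).2⟩, fun hm => ?_⟩
        have := h1 _ hm; omega
    rw [h1, h2] at h0
    linear_combination h0
  · rw [one_mul]
    apply gf_congr
    intro s _
    constructor
    · intro h1 a ha
      have : a ≠ M + 1 := by rintro rfl; exact h (h1 _ ha).2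
      have := h1 a ha
      exact ⟨by omega, this.2⟩
    · intro h1 a ha
      exact ⟨by have := h1 a ha; omega, (h1 a ha).2⟩

open scoped Classical in
theorem H_main {q : A} {T : ℕ} (hq : q ^ T = 0) (al : ℕ → Prop) (W : ℕ) (hW : T ≤ W) :
    (∏ j ∈ range W, if al (j + 1) then 1 - q ^ (j + 1) else 1) * gf q T (Hp al 0) = 1 := by
  have : ∀ m, (∏ j ∈ range m, if al (j + 1) then 1 - q ^ (j + 1) else 1) * gf q T (Hp al 0) =
      gf q T (Hp al m) := by
    intro m
    induction m with
    | zero => simp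
    | succ m ih => rw [prod_range_succ, mul_right_comm, ih, mul_comm, H_rec hq]
  rw [this, gf_one hq]
  · intro a ha; simp at ha
  · intro s hs a ha
    have := hs a ha; omega

/-- Parts allowed on the product side. -/
def al (k i a : ℕ) : Prop :=
  a % (2 * k + 1) ≠ 0 ∧ a % (2 * k + 1) ≠ i ∧ a % (2 * k + 1) ≠ 2 * k + 1 - i

open scoped Classical in
theorem prod_notal (q : A) {k i : ℕ} (hi : 1 ≤ i) (hik : i ≤ k) (L : ℕ) :
    (∏ j ∈ range ((2 * k + 1) * L), if al k i (j + 1) then 1 else 1 - q ^ (j + 1)) =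
    qf (q ^ (2 * k + 1)) L *
      ((∏ j ∈ range L, (1 - q ^ ((2 * k + 1) * j + i))) *
        ∏ j ∈ range L, (1 - q ^ ((2 * k + 1) * j + (2 * k + 1 - i)))) := by
  induction L with
  | zero => simp [qf]
  | succ L ih =>
    rw [mul_add, mul_one, prod_range_add, ih, qf_succ, prod_range_succ _ L, prod_range_succ _ L]
    have : (∏ x ∈ range (2 * k + 1), if al k i ((2 * k + 1) * L + x + 1) then 1
        else 1 - q ^ ((2 * k + 1) * L + x + 1)) =
        ∏ x ∈ ({2 * k, i - 1, 2 * k - i} : Finset ℕ), (1 - q ^ ((2 * k + 1) * L + x + 1)) := by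
      rw [prod_ite, prod_const_one, one_mul]
      congr 1
      ext x
      simp only [mem_filter, mem_range, mem_insert, mem_singleton, al, add_assoc,
        Nat.mul_add_mod]
      constructor
      · rintro ⟨h1, h2⟩
        rcases Nat.lt_or_ge (x + 1) (2 * k + 1) with h | h
        · rw [Nat.mod_eq_of_lt h] at h2; omega
        · omega
      · rintro (rfl | rfl | rfl)
        · simp
        · rw [Nat.mod_eq_of_lt (by omega)]; omega
        · rw [Nat.mod_eq_of_lt (by omega)]; omega
    rw [this, prod_insert, prod_insert, prod_singleton]
    · rw [← pow_mul, show (2 * k + 1) * L + (2 * k) + 1 = (2 * k + 1) * (L + 1) by ring,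
        show (2 * k + 1) * L + (i - 1) + 1 = (2 * k + 1) * L + i by omega,
        show (2 * k + 1) * L + (2 * k - i) + 1 = (2 * k + 1) * L + (2 * k + 1 - i) by omega]
      ring
    · simp; omega
    · simp; omega

theorem gf_eq {q : A} {T k i : ℕ} (hq : q ^ T = 0) (hi : 1 ≤ i) (hik : i ≤ k) :
    gf q T (Gp k i 0) = gf q T (Hp (al k i) 0) := by
  classical
  have hW : T ≤ (2 * k + 1) * (2 * T + 1) := by nlinarith
  have h1 := G_main (k := k) hq (Nat.le_succ T) (Nat.succ_pos T) ((2 * k + 1) * (2 * T + 1)) hW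
    ((2 * k + 1) * (2 * T + 1)) 0 rfl i hik
  rw [S_eq_prod hq hi hik (le_refl (2 * T)) (Nat.le_succ T), ← prod_notal q hi hik] at h1
  have h2 := H_main hq (al k i) ((2 * k + 1) * (2 * T + 1)) hW
  apply (qf_unit hq ((2 * k + 1) * (2 * T + 1))).mul_left_cancel
  rw [h1]
  have h3 : qf q ((2 * k + 1) * (2 * T + 1)) =
    (∏ j ∈ range ((2 * k + 1) * (2 * T + 1)), if al k i (j + 1) then 1 else 1 - q ^ (j + 1)) *
    (∏ j ∈ range ((2 * k + 1) * (2 * T + 1)), if al k i (j + 1) then 1 - q ^ (j + 1) else 1) := by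
    rw [qf, ← prod_mul_distrib]
    apply prod_congr rfl
    intro j _
    split_ifs <;> simp
  rw [h3, mul_assoc, h2, mul_one]

end comb

section extract
open Polynomial

open scoped Classical in
theorem card_parts (n : ℕ) (P : Multiset ℕ → Prop) :
    Nat.card {p : n.Partition // P p.parts} =
      (((U (n + 1)).filter P).filter (fun s => s.sum = n)).card := by
  rw [Nat.card_eq_fintype_card, Fintype.card_subtype]
  apply Finset.card_bij (fun p _ => p.parts)
  · intro p hp
    simp only [mem_filter, mem_univ, true_and, mem_U] at hp ⊢
    exact ⟨⟨⟨by rw [p.parts_sum]; omega, fun a ha => p.parts_pos ha⟩, hp⟩, p.parts_sum⟩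
  · intro p _ p' _ h
    exact Nat.Partition.ext h
  · intro s hs
    simp only [mem_filter, mem_univ, true_and, mem_U] at hs ⊢
    exact ⟨⟨s, fun {a} ha => hs.1.1.2 a ha, hs.2⟩, hs.1.2, rfl⟩

open scoped Classical in
theorem coeff_gf (n T : ℕ) (P : Multiset ℕ → Prop) :
    (gf (X : ℤ[X]) T P).coeff n = (((U T).filter P).filter (fun s => s.sum = n)).card := by
  rw [gf, Polynomial.finsetSum_coeff]
  simp only [coeff_X_pow]
  rw [Finset.sum_boole]
  congr 3
  ext s
  exact eq_comm

theorem card_eq {k i : ℕ} (hi : 1 ≤ i) (hik : i ≤ k) (n : ℕ) :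
    Nat.card {p : n.Partition // Gp k i 0 p.parts} =
    Nat.card {p : n.Partition // Hp (al k i) 0 p.parts} := by
  classical
  rw [card_parts, card_parts]
  have hm : ∀ P, gf (Ideal.Quotient.mk (Ideal.span {(X : ℤ[X]) ^ (n + 1)}) X) (n + 1) P =
      Ideal.Quotient.mk (Ideal.span {(X : ℤ[X]) ^ (n + 1)}) (gf X (n + 1) P) := by
    intro P
    simp [gf]
  have hq : (Ideal.Quotient.mk (Ideal.span {(X : ℤ[X]) ^ (n + 1)}) X) ^ (n + 1) = 0 := by
    rw [← map_pow, Ideal.Quotient.eq_zero_iff_mem]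
    exact Ideal.mem_span_singleton_self _
  have h := gf_eq hq hi hik
  rw [hm, hm, Ideal.Quotient.eq, Ideal.mem_span_singleton, X_pow_dvd_iff] at h
  have h := h n (by omega)
  rw [coeff_sub, coeff_gf, coeff_gf, sub_eq_zero] at h
  exact_mod_cast h

end extract

section gap

theorem sorted_countP (l : List ℕ) (hl : l.Pairwise (· ≤ ·)) (v j : ℕ) (hj : j < l.length) :
    l.getD j 0 < v ↔ j < l.countP (· < v) := by
  induction l generalizing j with
  | nil => simp at hj
  | cons a l ih =>
    rw [List.pairwise_cons] at hl
    rw [List.countP_cons]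
    cases j with
    | zero =>
      simp only [List.getD_cons_zero]
      by_cases h : a < v
      · simp [h]
      · simp only [h, decide_false, false_iff]
        have : l.countP (· < v) = 0 := by
          rw [List.countP_eq_zero]
          intro b hb
          have := hl.1 b hb
          simp; omega
        simp [this]
    | succ j =>
      simp only [List.getD_cons_succ]
      have hj' : j < l.length := by simpa using hj
      rw [ih hl.2 j hj']
      by_cases h : a < v
      · simp [h]
      · have : l.countP (· < v) = 0 := by
          rw [List.countP_eq_zero]
          intro b hb
          have := hl.1 b hb
          simp; omega
        simp [this, h]

theorem countP_two (l : List ℕ) (v : ℕ) :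
    l.countP (· < v + 2) = l.countP (· < v) + l.count v + l.count (v + 1) := by
  induction l with
  | nil => simp
  | cons a l ih =>
    simp only [List.countP_cons, List.count_cons, ih, beq_iff_eq, decide_eq_true_eq]
    split_ifs <;> omega

theorem gap_iff {k : ℕ} (hk : 1 ≤ k) (l : List ℕ) (hl : l.Pairwise (· ≤ ·)) :
    GordonGap k l ↔ ∀ v, l.count v + l.count (v + 1) < k := by
  constructor
  · intro h v
    by_contra hc
    have h2 := countP_two l v
    have h3 : l.countP (· < v + 2) ≤ l.length := List.countP_le_length
    have h4 := h (l.countP (· < v)) (by omega)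
    have h5 := sorted_countP l hl v (l.countP (· < v)) (by omega)
    have h6 := sorted_countP l hl (v + 2) (l.countP (· < v) + (k - 1)) (by omega)
    have h7 := h6.2 (by omega)
    have h8 : ¬ _ := fun hh => lt_irrefl _ (h5.1 hh)
    omega
  · intro h j hj
    by_contra hc
    have h1 := h (l.getD j 0)
    have h2 := countP_two l (l.getD j 0)
    have h5 := sorted_countP l hl (l.getD j 0) j (by omega)
    have h6 := sorted_countP l hl (l.getD j 0 + 2) (j + (k - 1)) hj
    have h7 := h6.1 (by omega)
    have h8 : ¬ _ := fun hh => lt_irrefl _ (h5.2 hh)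
    omega

theorem gordon_iff {k i n : ℕ} (hi : 1 ≤ i) (hik : i ≤ k) (p : n.Partition) :
    (p.parts.count 1 ≤ i - 1 ∧ GordonGap k (p.parts.sort (· ≤ ·))) ↔ Gp k i 0 p.parts := by
  rw [gap_iff (by omega) _ (Multiset.pairwise_sort _ _)]
  have hcount : ∀ v, (p.parts.sort (· ≤ ·)).count v = p.parts.count v := by
    intro v
    rw [← Multiset.coe_count, Multiset.sort_eq]
  simp only [hcount, Gp, zero_add]
  constructor
  · rintro ⟨h1, h2⟩
    exact ⟨fun a ha => p.parts_pos ha, by omega, h2⟩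
  · rintro ⟨_, h1, h2⟩
    exact ⟨by omega, h2⟩

end gap
end GordonRR

/-- Gordon's generalization of the Rogers–Ramanujan identities.
Let `k ≥ i ≥ 1` be integers.  For every nonnegative integer `n`, the number of
partitions `b₁ ≥ b₂ ≥ ⋯ ≥ b_s` of `n` such that at most `i − 1` of the parts equal `1`
and `b_j − b_{j+k−1} ≥ 2` for all `1 ≤ j ≤ s − k + 1`, equals the number of partitions
of `n` into parts not congruent to `0`, `i`, or `−i` modulo `2k + 1`. -/
theorem statement7 (k i : ℕ) (hi : 1 ≤ i) (hik : i ≤ k) (n : ℕ) :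
    Nat.card {p : n.Partition //
      p.parts.count 1 ≤ i - 1 ∧ GordonGap k (p.parts.sort (· ≤ ·))} =
    Nat.card {p : n.Partition //
      ∀ a ∈ p.parts, a % (2 * k + 1) ≠ 0 ∧ a % (2 * k + 1) ≠ i ∧
        a % (2 * k + 1) ≠ 2 * k + 1 - i} := by
  have h := GordonRR.card_eq hi hik n
  have h1 : Nat.card {p : n.Partition //
      p.parts.count 1 ≤ i - 1 ∧ GordonGap k (p.parts.sort (· ≤ ·))} =
      Nat.card {p : n.Partition // GordonRR.Gp k i 0 p.parts} :=
    Nat.card_congr (Equiv.subtypeEquivRight fun p => GordonRR.gordon_iff hi hik p)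
  rw [h1, h]
  refine Nat.card_congr (Equiv.subtypeEquivRight fun p => ?_)
  exact ⟨fun h a ha => (h a ha).2, fun h a ha => ⟨p.parts_pos ha, h a ha⟩⟩
end

section
/- Capparelli's first identity: for every nonnegative integer n, the number of partitions of n into distinct parts, none congruent to 1 or 5 modulo 6, equals the number of partitions c₁ ≥ c₂ ≥ ⋯ ≥ c_s of n such that every part is at least 2, c_j − c_{j+1} ≥ 2 for all 1 ≤ j < s, and whenever c_j − c_{j+1} equals 2 or 3 one has either c_j + c_{j+1} ≡ 0 (mod 6) or both c_j ≡ 0 (mod 3) and c_{j+1} ≡ 0 (mod 3). -/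
/-- The Capparelli gap condition between two consecutive parts `a ≤ b` (i.e. `b = c_j`
and `a = c_{j+1}` in weakly decreasing order): they differ by at least `2`, and if they
differ by exactly `2` or `3` then either `c_j + c_{j+1} ≡ 0 (mod 6)` or both parts are
divisible by `3`. -/
def CapparelliGap (a b : ℕ) : Prop :=
  a + 2 ≤ b ∧ ((b - a = 2 ∨ b - a = 3) → ((a + b) % 6 = 0 ∨ (a % 3 = 0 ∧ b % 3 = 0)))

namespace Capp
open PowerSeries

/-- number of parts congruent to `r` mod `3` -/
def cnt (r : ℕ) (s : Finset ℕ) : ℕ := (s.filter (fun x => x % 3 = r)).card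

/-- the refined class -/
def cls (A : Set (Finset ℕ)) (i j n : ℕ) : Set (Finset ℕ) :=
  {s | s ∈ A ∧ ∑ x ∈ s, x = n ∧ cnt 1 s = i ∧ cnt 2 s = j}

/-- refined generating function -/
noncomputable def gf (A : Set (Finset ℕ)) (i j : ℕ) : PowerSeries ℤ :=
  PowerSeries.mk fun n => ((cls A i j n).ncard : ℤ)

lemma sum_finite (n : ℕ) : {s : Finset ℕ | ∑ x ∈ s, x = n}.Finite := by
  apply Set.Finite.subset (Finset.finite_toSet (Finset.range (n+1)).powerset)
  intro s hs
  simp only [Set.mem_ofPred_eq] at hs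
  simp only [Finset.coe_powerset, Set.mem_preimage, Set.mem_powerset_iff, Finset.coe_subset]
  intro x hx
  have := Finset.single_le_sum (f := fun x : ℕ => x) (fun _ _ => Nat.zero_le _) hx
  simp only [Finset.mem_range]
  omega

lemma cls_finite (A : Set (Finset ℕ)) (i j n : ℕ) : (cls A i j n).Finite :=
  (sum_finite n).subset fun _ hs => hs.2.1

lemma gf_union {A B : Set (Finset ℕ)} (h : Disjoint A B) (i j : ℕ) :
    gf (A ∪ B) i j = gf A i j + gf B i j := by
  ext n
  simp only [gf, coeff_mk, map_add]
  have : cls (A ∪ B) i j n = cls A i j n ∪ cls B i j n := by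
    ext s; simp only [cls, Set.mem_union, Set.mem_ofPred_eq]; tauto
  rw [this, Set.ncard_union_eq _ (cls_finite _ _ _ _) (cls_finite _ _ _ _)]
  · push_cast; rfl
  · exact h.mono (fun _ hs => hs.1) (fun _ hs => hs.1)

lemma cnt_insert (r m : ℕ) (s : Finset ℕ) (h : m ∉ s) :
    cnt r (insert m s) = cnt r s + if m % 3 = r then 1 else 0 := by
  unfold cnt
  rw [Finset.filter_insert]
  split_ifs with h1
  · rw [Finset.card_insert_of_notMem (by simp [h])]
  · simp

lemma gf_insert_gen {A : Set (Finset ℕ)} {m : ℕ} (h : ∀ s ∈ A, m ∉ s) (i j i' j' : ℕ)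
    (hi : i = i' + if m % 3 = 1 then 1 else 0) (hj : j = j' + if m % 3 = 2 then 1 else 0) :
    gf (insert m '' A) i j = X ^ m * gf A i' j' := by
  ext n
  rw [coeff_X_pow_mul']
  simp only [gf, coeff_mk]
  split_ifs with hn
  · have : cls (insert m '' A) i j n = insert m '' (cls A i' j' (n - m)) := by
      ext s
      constructor
      · rintro ⟨⟨t, ht, rfl⟩, h1, h2, h3⟩
        have hm := h t ht
        rw [Finset.sum_insert hm] at h1
        rw [cnt_insert _ _ _ hm] at h2 h3
        exact ⟨t, ⟨ht, by omega, by omega, by omega⟩, rfl⟩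
      · rintro ⟨t, ⟨ht, h1, h2, h3⟩, rfl⟩
        have hm := h t ht
        refine ⟨⟨t, ht, rfl⟩, ?_, ?_, ?_⟩
        · rw [Finset.sum_insert hm]; omega
        · rw [cnt_insert _ _ _ hm]; omega
        · rw [cnt_insert _ _ _ hm]; omega
    rw [this, Set.InjOn.ncard_image]
    intro s hs t ht hst
    have h1 := h s hs.1
    have h2 := h t ht.1
    rw [← Finset.erase_insert h1, hst, Finset.erase_insert h2]
  · have : cls (insert m '' A) i j n = ∅ := by
      ext s
      simp only [Set.mem_empty_iff_false, iff_false]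
      rintro ⟨⟨t, ht, rfl⟩, h1, h2, h3⟩
      have hm := h t ht
      rw [Finset.sum_insert hm] at h1
      omega
    simp [this]

lemma gf_insert_zero {A : Set (Finset ℕ)} {m : ℕ} (h : ∀ s ∈ A, m ∉ s) (i j : ℕ)
    (hi : (m % 3 = 1 ∧ i = 0) ∨ (m % 3 = 2 ∧ j = 0)) :
    gf (insert m '' A) i j = 0 := by
  ext n
  simp only [gf, coeff_mk]
  have : cls (insert m '' A) i j n = ∅ := by
    ext s
    simp only [Set.mem_empty_iff_false, iff_false]
    rintro ⟨⟨t, ht, rfl⟩, h1, h2, h3⟩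
    have hm := h t ht
    rw [cnt_insert _ _ _ hm] at h2 h3
    rcases hi with ⟨h4, h5⟩ | ⟨h4, h5⟩ <;> simp [h4] at h2 h3 <;> omega
  simp [this]

/-- q-Pochhammer -/
noncomputable def Dp (i : ℕ) : PowerSeries ℤ := ∏ t ∈ Finset.range i, (1 - X ^ (6 * (t + 1)))

/-- normalised generating function -/
noncomputable def hf (A : Set (Finset ℕ)) (i j : ℕ) : PowerSeries ℤ := Dp i * Dp j * gf A i j

lemma Dp_succ (i : ℕ) : Dp (i+1) = Dp i * (1 - X ^ (6 * (i + 1))) := by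
  unfold Dp; rw [Finset.prod_range_succ]

lemma Dp_zero : Dp 0 = 1 := by simp [Dp]

lemma hf_union {A B : Set (Finset ℕ)} (h : Disjoint A B) (i j : ℕ) :
    hf (A ∪ B) i j = hf A i j + hf B i j := by
  unfold hf; rw [gf_union h]; ring

lemma hf_insert0 {A : Set (Finset ℕ)} {m : ℕ} (h : ∀ s ∈ A, m ∉ s) (hm : m % 3 = 0) (i j : ℕ) :
    hf (insert m '' A) i j = X ^ m * hf A i j := by
  unfold hf
  rw [gf_insert_gen h i j i j (by simp [hm]) (by simp [hm])]; ring

lemma hf_insert1 {A : Set (Finset ℕ)} {m : ℕ} (h : ∀ s ∈ A, m ∉ s) (hm : m % 3 = 1) (i j : ℕ) :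
    hf (insert m '' A) i j = X ^ m * (1 - X ^ (6 * i)) * hf A (i - 1) j := by
  unfold hf
  rcases i with _ | i
  · rw [gf_insert_zero h _ _ (Or.inl ⟨hm, rfl⟩)]; simp
  · rw [gf_insert_gen h (i+1) j i j (by simp [hm]) (by simp [hm]), Dp_succ]
    simp only [Nat.add_sub_cancel]; ring

lemma hf_insert2 {A : Set (Finset ℕ)} {m : ℕ} (h : ∀ s ∈ A, m ∉ s) (hm : m % 3 = 2) (i j : ℕ) :
    hf (insert m '' A) i j = X ^ m * (1 - X ^ (6 * j)) * hf A i (j - 1) := by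
  unfold hf
  rcases j with _ | j
  · rw [gf_insert_zero h _ _ (Or.inr ⟨hm, rfl⟩)]; simp
  · rw [gf_insert_gen h i (j+1) i j (by simp [hm]) (by simp [hm]), Dp_succ]
    simp only [Nat.add_sub_cancel]; ring

lemma hf_dvd {A : Set (Finset ℕ)} {m : ℕ} (h : ∀ s ∈ A, ∀ x ∈ s, m ≤ x) (i j : ℕ)
    (hij : i + j ≠ 0) : X ^ m ∣ hf A i j := by
  refine Dvd.dvd.mul_left ?_ _
  rw [X_pow_dvd_iff]
  intro n hn
  simp only [gf, coeff_mk]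
  have : cls A i j n = ∅ := by
    ext s
    simp only [Set.mem_empty_iff_false, iff_false]
    rintro ⟨ht, h1, h2, h3⟩
    rcases s.eq_empty_or_nonempty with rfl | ⟨x, hx⟩
    · simp [cnt] at h2 h3; omega
    · have := Finset.single_le_sum (f := fun x : ℕ => x) (fun _ _ => Nat.zero_le _) hx
      have := h s ht x hx
      omega
  simp [this]

lemma hf_dvd0 {A : Set (Finset ℕ)} {m : ℕ} (h : ∀ s ∈ A, ∀ x ∈ s, m ≤ x) (h0 : ∅ ∈ A) :
    X ^ m ∣ hf A 0 0 - 1 := by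
  unfold hf
  rw [Dp_zero, one_mul, one_mul]
  rw [X_pow_dvd_iff]
  intro n hn
  simp only [gf, coeff_mk, map_sub, coeff_one]
  split_ifs with hn0
  · subst hn0
    have : cls A 0 0 0 = {∅} := by
      ext s
      simp only [Set.mem_singleton_iff]
      constructor
      · rintro ⟨ht, h1, h2, h3⟩
        rcases s.eq_empty_or_nonempty with rfl | ⟨x, hx⟩
        · rfl
        · have := Finset.single_le_sum (f := fun x : ℕ => x) (fun _ _ => Nat.zero_le _) hx
          have := h s ht x hx
          omega
      · rintro rfl
        exact ⟨h0, by simp, by simp [cnt], by simp [cnt]⟩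
    simp [this]
  · have : cls A 0 0 n = ∅ := by
      ext s
      simp only [Set.mem_empty_iff_false, iff_false]
      rintro ⟨ht, h1, h2, h3⟩
      rcases s.eq_empty_or_nonempty with rfl | ⟨x, hx⟩
      · simp at h1; omega
      · have := Finset.single_le_sum (f := fun x : ℕ => x) (fun _ _ => Nat.zero_le _) hx
        have := h s ht x hx
        omega
    simp [this]

/-- gap sets with all parts at least `m` -/
def GG (m : ℕ) : Set (Finset ℕ) :=
  {s | (∀ x ∈ s, m ≤ x) ∧ ∀ x ∈ s, ∀ y ∈ s, x < y → CapparelliGap x y}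

/-- distinct part sets with all parts at least `m` -/
def PP (m : ℕ) : Set (Finset ℕ) :=
  {s | ∀ x ∈ s, m ≤ x ∧ ¬(x % 6 = 1 ∨ x % 6 = 5)}

lemma mem_GG {m : ℕ} {s : Finset ℕ} :
    s ∈ GG m ↔ (∀ x ∈ s, m ≤ x) ∧ ∀ x ∈ s, ∀ y ∈ s, x < y → CapparelliGap x y := Iff.rfl

lemma mem_PP {m : ℕ} {s : Finset ℕ} :
    s ∈ PP m ↔ ∀ x ∈ s, m ≤ x ∧ ¬(x % 6 = 1 ∨ x % 6 = 5) := Iff.rfl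

lemma split {A B C : Set (Finset ℕ)} {m : ℕ} (h1 : ∀ s, m ∉ s → (s ∈ A ↔ s ∈ B))
    (h2 : ∀ s, m ∉ s → (insert m s ∈ A ↔ s ∈ C)) (hB : ∀ s ∈ B, m ∉ s) (hC : ∀ s ∈ C, m ∉ s) :
    A = B ∪ insert m '' C ∧ Disjoint B (insert m '' C) := by
  constructor
  · ext s
    by_cases hm : m ∈ s
    · have hs : insert m (s.erase m) = s := Finset.insert_erase hm
      constructor
      · intro hA
        right
        refine ⟨s.erase m, ?_, hs⟩
        rw [← h2 _ (by simp), hs]; exact hA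
      · rintro (hs' | ⟨t, ht, rfl⟩)
        · exact absurd hm (hB s hs')
        · exact (h2 t (hC t ht)).2 ht
    · rw [h1 s hm]
      constructor
      · intro h; exact Or.inl h
      · rintro (hs' | ⟨t, ht, rfl⟩)
        · exact hs'
        · exact absurd (Finset.mem_insert_self m t) hm
  · rw [Set.disjoint_left]
    rintro s hs ⟨t, ht, rfl⟩
    exact hB _ hs (Finset.mem_insert_self m t)

lemma insert_GG {m k : ℕ} {s : Finset ℕ} :
    insert m s ∈ GG k ↔ k ≤ m ∧ s ∈ GG k ∧
      ∀ x ∈ s, (x < m → CapparelliGap x m) ∧ (m < x → CapparelliGap m x) := by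
  simp only [mem_GG, Finset.forall_mem_insert, lt_irrefl, false_imp_iff, true_and]
  constructor
  · rintro ⟨⟨h1, h2⟩, h3, h4⟩
    exact ⟨h1, ⟨h2, fun x hx => (h4 x hx).2⟩, fun x hx => ⟨(h4 x hx).1, h3 x hx⟩⟩
  · rintro ⟨h1, ⟨h2, h3⟩, h4⟩
    exact ⟨⟨h1, h2⟩, fun x hx => (h4 x hx).2, fun x hx => ⟨(h4 x hx).1, h3 x hx⟩⟩

lemma ge_ne {m : ℕ} {s : Finset ℕ} (h : m ∉ s) (h2 : ∀ x ∈ s, m ≤ x) : ∀ x ∈ s, m + 1 ≤ x := by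
  intro x hx
  have := h2 x hx
  rcases this.eq_or_lt with rfl | h3
  · exact absurd hx h
  · exact h3

lemma GG_skip {m : ℕ} (s : Finset ℕ) (h : m ∉ s) : s ∈ GG m ↔ s ∈ GG (m + 1) := by
  rw [mem_GG, mem_GG]
  exact ⟨fun h1 => ⟨ge_ne h h1.1, h1.2⟩, fun h1 => ⟨fun x hx => by have := h1.1 x hx; omega, h1.2⟩⟩

lemma GG_notMem {m k : ℕ} (hk : m < k) : ∀ s ∈ GG k, m ∉ s := by
  intro s hs hm
  have := hs.1 m hm
  omega

lemma GG_step0 {m : ℕ} (hm : m % 3 = 0) : GG m = GG (m+1) ∪ insert m '' GG (m+3) ∧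
    Disjoint (GG (m+1)) (insert m '' GG (m+3)) := by
  apply split GG_skip _ (GG_notMem (by omega)) (GG_notMem (by omega))
  intro s hs
  rw [insert_GG, GG_skip s hs]
  constructor
  · rintro ⟨-, h1, h2⟩
    refine ⟨fun x hx => ?_, h1.2⟩
    have h3 := h1.1 x hx
    have h4 := (h2 x hx).2 (by omega)
    unfold CapparelliGap at h4
    omega
  · intro h
    refine ⟨le_rfl, ⟨fun x hx => by have := h.1 x hx; omega, h.2⟩, fun x hx => ?_⟩
    have := h.1 x hx
    unfold CapparelliGap
    omega

lemma GG_step1 {m : ℕ} (hm : m % 3 = 1) : GG m = GG (m+1) ∪ insert m '' GG (m+4) ∧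
    Disjoint (GG (m+1)) (insert m '' GG (m+4)) := by
  apply split GG_skip _ (GG_notMem (by omega)) (GG_notMem (by omega))
  intro s hs
  rw [insert_GG, GG_skip s hs]
  constructor
  · rintro ⟨-, h1, h2⟩
    refine ⟨fun x hx => ?_, h1.2⟩
    have h3 := h1.1 x hx
    have h4 := (h2 x hx).2 (by omega)
    unfold CapparelliGap at h4
    omega
  · intro h
    refine ⟨le_rfl, ⟨fun x hx => by have := h.1 x hx; omega, h.2⟩, fun x hx => ?_⟩
    have := h.1 x hx
    unfold CapparelliGap
    omega

/-- gap sets without `m+3` -/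
def GC (m : ℕ) : Set (Finset ℕ) := {s | s ∈ GG (m+2) ∧ m + 3 ∉ s}

lemma GG_step2 {m : ℕ} (hm : m % 3 = 2) : GG m = GG (m+1) ∪ insert m '' GC m ∧
    Disjoint (GG (m+1)) (insert m '' GC m) := by
  apply split GG_skip _ (GG_notMem (by omega)) (fun s hs => GG_notMem (by omega) s hs.1)
  intro s hs
  rw [insert_GG, GG_skip s hs]
  constructor
  · rintro ⟨-, h1, h2⟩
    refine ⟨⟨fun x hx => ?_, h1.2⟩, fun hx => ?_⟩
    · have h3 := h1.1 x hx
      have h4 := (h2 x hx).2 (by omega)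
      unfold CapparelliGap at h4
      omega
    · have h4 := (h2 _ hx).2 (by omega)
      unfold CapparelliGap at h4
      omega
  · intro h
    refine ⟨le_rfl, ⟨fun x hx => by have := h.1.1 x hx; omega, h.1.2⟩, fun x hx => ?_⟩
    have := h.1.1 x hx
    have h5 : x ≠ m + 3 := by rintro rfl; exact h.2 hx
    unfold CapparelliGap
    omega

lemma GC_step {m : ℕ} (hm : m % 3 = 2) : GC m = GG (m+4) ∪ insert (m+2) '' GG (m+6) ∧
    Disjoint (GG (m+4)) (insert (m+2) '' GG (m+6)) := by
  apply split _ _ (GG_notMem (by omega)) (GG_notMem (by omega))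
  · intro s hs
    constructor
    · rintro ⟨h1, h2⟩
      rw [GG_skip s hs, GG_skip s h2] at h1
      exact h1
    · intro h
      have h3 : m + 3 ∉ s := GG_notMem (by omega) s h
      refine ⟨?_, h3⟩
      rw [GG_skip s hs, GG_skip s h3]
      exact h
  intro s hs
  constructor
  · rintro ⟨h1, h2⟩
    rw [insert_GG, GG_skip s hs] at h1
    obtain ⟨-, h1, h3⟩ := h1
    refine ⟨fun x hx => ?_, h1.2⟩
    have h4 := h1.1 x hx
    have h5 := (h3 x hx).2 (by omega)
    unfold CapparelliGap at h5
    omega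
  · intro h
    refine ⟨?_, ?_⟩
    · rw [insert_GG, GG_skip s hs]
      refine ⟨le_rfl, ⟨fun x hx => by have := h.1 x hx; omega, h.2⟩, fun x hx => ?_⟩
      have := h.1 x hx
      unfold CapparelliGap
      omega
    · rw [Finset.mem_insert]
      rintro (h1 | h1)
      · omega
      · exact GG_notMem (by omega) s h h1

lemma GG_recY (s i j : ℕ) : hf (GG (3*s+3)) i j = X^(3*s+3) * hf (GG (3*(s+1)+3)) i j
    + hf (GG (3*(s+1)+2)) i j + X^(3*s+4) * (1 - X^(6*i)) * hf (GG (3*(s+2)+2)) (i-1) j := by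
  have h0 := GG_step0 (m := 3*s+3) (by omega)
  have h1 := GG_step1 (m := 3*s+4) (by omega)
  rw [h0.1, hf_union h0.2, hf_insert0 (GG_notMem (by omega)) (by omega), h1.1, hf_union h1.2,
    hf_insert1 (GG_notMem (by omega)) (by omega)]
  have e1 : 3 * (s+1) + 3 = 3*s+3+3 := by ring
  have e2 : 3 * (s+1) + 2 = 3*s+4+1 := by ring
  have e3 : 3 * (s+2) + 2 = 3*s+4+4 := by ring
  rw [e1, e2, e3]
  ring

lemma GG_recX (s i j : ℕ) : hf (GG (3*s+2)) i j = hf (GG (3*s+3)) i j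
    + X^(3*s+2) * (1 - X^(6*j)) * hf (GG (3*(s+1)+3)) i (j-1)
    + X^(6*s+6) * (1 - X^(6*i)) * (1 - X^(6*j)) * hf (GG (3*(s+2)+2)) (i-1) (j-1) := by
  have h0 := GG_step2 (m := 3*s+2) (by omega)
  have h1 := GC_step (m := 3*s+2) (by omega)
  rw [h0.1, hf_union h0.2, hf_insert2 (fun s hs => GG_notMem (by omega) s hs.1) (by omega), h1.1,
    hf_union h1.2, hf_insert1 (GG_notMem (by omega)) (by omega)]
  have e1 : 3 * (s+1) + 3 = 3*s+2+4 := by ring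
  have e3 : 3 * (s+2) + 2 = 3*s+2+6 := by ring
  rw [e1, e3]
  ring

lemma PP_notMem {m k : ℕ} (hk : m < k) : ∀ s ∈ PP k, m ∉ s := by
  intro s hs hm
  have := hs m hm
  omega

lemma PP_skip {m : ℕ} (s : Finset ℕ) (h : m ∉ s) : s ∈ PP m ↔ s ∈ PP (m + 1) := by
  rw [mem_PP, mem_PP]
  refine ⟨fun h1 x hx => ⟨ge_ne h (fun x hx => (h1 x hx).1) x hx, (h1 x hx).2⟩,
    fun h1 x hx => ⟨by have := h1 x hx; omega, (h1 x hx).2⟩⟩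

lemma PP_step {m : ℕ} (hm : ¬ (m % 6 = 1 ∨ m % 6 = 5)) :
    PP m = PP (m+1) ∪ insert m '' PP (m+1) ∧ Disjoint (PP (m+1)) (insert m '' PP (m+1)) := by
  apply split PP_skip _ (PP_notMem (by omega)) (PP_notMem (by omega))
  intro s hs
  rw [← PP_skip s hs]
  simp only [mem_PP, Finset.forall_mem_insert]
  exact ⟨fun h => h.2, fun h => ⟨⟨le_rfl, hm⟩, h⟩⟩

lemma PP_step' {m : ℕ} (hm : m % 6 = 1 ∨ m % 6 = 5) : PP m = PP (m+1) := by
  ext s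
  by_cases h : m ∈ s
  · constructor
    · intro h1; exact absurd hm (h1 m h).2
    · intro h1; exact absurd h (PP_notMem (by omega) s h1)
  · exact PP_skip s h

lemma PP_rec0 {m : ℕ} (hm : m % 3 = 0) (i j : ℕ) :
    hf (PP m) i j = (1 + X^m) * hf (PP (m+1)) i j := by
  have h0 := PP_step (m := m) (by omega)
  rw [h0.1, hf_union h0.2, hf_insert0 (PP_notMem (by omega)) hm]
  ring

lemma PP_rec1 {m : ℕ} (hm : m % 6 = 4) (i j : ℕ) :
    hf (PP m) i j = hf (PP (m+1)) i j + X^m * (1 - X^(6*i)) * hf (PP (m+1)) (i-1) j := by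
  have h0 := PP_step (m := m) (by omega)
  rw [h0.1, hf_union h0.2, hf_insert1 (PP_notMem (by omega)) (by omega)]

lemma PP_rec2 {m : ℕ} (hm : m % 6 = 2) (i j : ℕ) :
    hf (PP m) i j = hf (PP (m+1)) i j + X^m * (1 - X^(6*j)) * hf (PP (m+1)) i (j-1) := by
  have h0 := PP_step (m := m) (by omega)
  rw [h0.1, hf_union h0.2, hf_insert2 (PP_notMem (by omega)) (by omega)]

lemma PP_rec (s i j : ℕ) : hf (PP (6*s+1)) i j = (1 + X^(6*s+3)) * (1 + X^(6*s+6)) *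
    (hf (PP (6*(s+1)+1)) i j + X^(6*s+2) * (1 - X^(6*j)) * hf (PP (6*(s+1)+1)) i (j-1)
      + X^(6*s+4) * (1 - X^(6*i)) * hf (PP (6*(s+1)+1)) (i-1) j
      + X^(12*s+6) * (1 - X^(6*i)) * (1 - X^(6*j)) * hf (PP (6*(s+1)+1)) (i-1) (j-1)) := by
  have key : ∀ i j, hf (PP (6*s+1+1+1)) i j = (1 + X^(6*s+3)) * (1 + X^(6*s+6)) *
    (hf (PP (6*(s+1)+1)) i j + X^(6*s+4) * (1 - X^(6*i)) * hf (PP (6*(s+1)+1)) (i-1) j) := by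
    intro i j
    rw [PP_rec0 (by omega), PP_rec1 (by omega), PP_step' (m := 6*s+1+1+1+1+1) (by omega),
      PP_rec0 (m := 6*s+1+1+1+1+1+1) (by omega) i j,
      PP_rec0 (m := 6*s+1+1+1+1+1+1) (by omega) (i-1) j]
    have e : 6 * (s+1) + 1 = 6*s+1+1+1+1+1+1+1 := by ring
    rw [e]; ring
  rw [PP_step' (m := 6*s+1) (by omega), PP_rec2 (by omega), key, key]
  ring

/-- multiples of three -/
noncomputable def EE (s : ℕ) : PowerSeries ℤ := hf (PP (3*s+1)) 0 0

lemma EE_rec (s : ℕ) : EE s = (1 + X^(3*s+3)) * EE (s+1) := by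
  have a1 : ∀ m, m % 3 ≠ 0 → hf (PP m) 0 0 = hf (PP (m+1)) 0 0 := by
    intro m hm
    have : m % 6 = 1 ∨ m % 6 = 5 ∨ m % 6 = 4 ∨ m % 6 = 2 := by omega
    rcases this with h | h | h | h
    · rw [PP_step' (Or.inl h)]
    · rw [PP_step' (Or.inr h)]
    · rw [PP_rec1 h]; simp
    · rw [PP_rec2 h]; simp
  unfold EE
  rw [a1 _ (by omega), a1 _ (by omega), PP_rec0 (by omega)]
  rfl

lemma EE_dvd (s : ℕ) : X ^ s ∣ EE s - 1 :=
  (pow_dvd_pow X (by omega)).trans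
    (hf_dvd0 (m := 3*s+1) (fun t ht x hx => (ht x hx).1) (by simp [mem_PP]))

/-- product of one plus powers -/
noncomputable def MM (n : ℕ) : PowerSeries ℤ := ∏ t ∈ Finset.range n, (1 + X ^ (3 * (t + 1)))

lemma MM_succ (n : ℕ) : MM (n+1) = MM n * (1 + X ^ (3 * (n + 1))) := by
  unfold MM; rw [Finset.prod_range_succ]

lemma MM_EE (n : ℕ) : MM n * EE n = EE 0 := by
  induction n with
  | zero => simp [MM]
  | succ n ih => rw [MM_succ, ← ih, EE_rec n]; ring

/-- exponent of the class two mod three -/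
def bexp : ℕ → ℕ
  | 0 => 0
  | j + 1 => bexp j + 6 * j + 2

/-- candidate -/
noncomputable def xc (s i j : ℕ) : PowerSeries ℤ :=
  EE (s+i+j) * MM (i+j) * X ^ (3*s*(i+j) + (3*i^2+i) + bexp j)

/-- second candidate -/
noncomputable def yc (s i j : ℕ) : PowerSeries ℤ :=
  if i + j = 0 then xc s i j else
  EE (s+i+j) * MM (i+j-1) * (X^(3*(i+j)) + X^(6*j)) * X ^ (3*s*(i+j) + (3*i^2+i) + bexp j)

lemma yc_mul (s i j : ℕ) :
    (1 + X^(3*(i+j))) * yc s i j = (X^(3*(i+j)) + X^(6*j)) * xc s i j := by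
  unfold yc
  split_ifs with h
  · obtain ⟨rfl, rfl⟩ : i = 0 ∧ j = 0 := by omega
    simp
  · unfold xc
    obtain ⟨n, hn⟩ : ∃ n, i + j = n + 1 := ⟨i + j - 1, by omega⟩
    rw [hn, MM_succ]
    simp only [Nat.add_sub_cancel]
    ring

lemma one_add_ne (n : ℕ) : (1 + X^n : PowerSeries ℤ) ≠ 0 := by
  intro h
  have := congrArg (coeff 0) h
  rw [map_add, coeff_X_pow] at this
  simp at this
  split_ifs at this <;> omega

lemma xc_recY (s i j : ℕ) : yc s i j = X^(3*s+3) * yc (s+1) i j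
    + xc (s+1) i j + X^(3*s+4) * (1 - X^(6*i)) * xc (s+2) (i-1) j := by
  apply mul_left_cancel₀ (one_add_ne (3*(i+j)))
  have h1 := yc_mul s i j
  have h2 := yc_mul (s+1) i j
  have hE := EE_rec (s+i+j)
  have e1 : EE (s + 1 + i + j) = EE (s+i+j+1) := by congr 1; ring
  rcases i with _ | i
  · simp only [xc] at h1 h2 ⊢
    rw [e1] at h2 ⊢
    rw [hE] at h1
    simp only [mul_add]
    linear_combination h1 - X^(3*s+3) * h2
  · simp only [xc, Nat.add_sub_cancel] at h1 h2 ⊢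
    have e2 : EE (s + 2 + i + j) = EE (s + (i+1) + j + 1) := by congr 1; ring
    have e3 : MM (i + 1 + j) = MM (i + j) * (1 + X ^ (3 * (i + j + 1))) := by
      rw [← MM_succ]; congr 1; ring
    rw [e1, e3] at h2 ⊢
    rw [e2]
    rw [hE, e3] at h1
    linear_combination h1 - X^(3*s+3) * h2

lemma xc_recX (s i j : ℕ) : xc s i j = yc s i j
    + X^(3*s+2) * (1 - X^(6*j)) * yc (s+1) i (j-1)
    + X^(6*s+6) * (1 - X^(6*i)) * (1 - X^(6*j)) * xc (s+2) (i-1) (j-1) := by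
  rcases j with _ | j
  · apply mul_left_cancel₀ (one_add_ne (3*(i+0)))
    have h1 := yc_mul s i 0
    linear_combination -h1
  apply mul_left_cancel₀ (one_add_ne (3*(i+(j+1))))
  apply mul_left_cancel₀ (one_add_ne (3*(i+j)))
  have h1 := yc_mul s i (j+1)
  have h2 := yc_mul (s+1) i j
  have e1 : EE (s + 1 + i + j) = EE (s + i + (j + 1)) := by congr 1; ring
  have e3 : MM (i + (j + 1)) = MM (i + j) * (1 + X ^ (3 * (i + j + 1))) := MM_succ _
  simp only [xc, Nat.add_sub_cancel, bexp] at h1 h2 ⊢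
  rw [e1] at h2
  rw [e3] at h1 ⊢
  rcases i with _ | i
  · linear_combination -(1 + X^(3*(0+j))) * h1 -
      (1 + X^(3*(0+j+1))) * X^(3*s+2) * (1 - X^(6*(j+1))) * h2
  · have e2 : EE (s + 2 + i + j) = EE (s + (i+1) + (j + 1)) := by congr 1; ring
    have e4 : MM (i + 1 + j) = MM (i + j) * (1 + X ^ (3 * (i + j + 1))) := by
      rw [← MM_succ]; congr 1; ring
    rw [e4] at h1 h2 ⊢
    simp only [Nat.add_sub_cancel]
    rw [e2]
    linear_combination -(1 + X^(3*(i+j+1))) * h1 -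
      (1 + X^(3*(i+j+1+1))) * X^(3*s+2) * (1 - X^(6*(j+1))) * h2

lemma eq_zero_of_dvd {f : PowerSeries ℤ} (h : ∀ n, X^n ∣ f) : f = 0 := by
  ext n
  have := h (n+1)
  rw [X_pow_dvd_iff] at this
  simpa using this n (by omega)

lemma base_G (s i j : ℕ) : X^s ∣ hf (GG (3*s+2)) i j - xc s i j := by
  have hG : ∀ t ∈ GG (3*s+2), ∀ x ∈ t, 3*s+2 ≤ x := fun t ht => ht.1
  by_cases h : i + j = 0
  · obtain ⟨rfl, rfl⟩ : i = 0 ∧ j = 0 := by omega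
    have h1 := (pow_dvd_pow X (show s ≤ 3*s+2 by omega)).trans
      (hf_dvd0 hG (by simp [mem_GG]))
    have h2 := EE_dvd s
    have h3 : xc s 0 0 = EE s := by simp [xc, MM, bexp]
    rw [h3]
    have := dvd_sub h1 h2
    simpa using this
  · apply dvd_sub
    · exact (pow_dvd_pow X (show s ≤ 3*s+2 by omega)).trans (hf_dvd hG i j h)
    · unfold xc
      apply Dvd.dvd.mul_left
      apply pow_dvd_pow
      have : s * 1 ≤ s * (i + j) := Nat.mul_le_mul_left _ (by omega)
      nlinarith

lemma hf_GG (s i j : ℕ) : hf (GG (3*s+2)) i j = xc s i j := by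
  have key : ∀ n, ∀ s i j, X^n ∣ hf (GG (3*s+2)) i j - xc s i j ∧
      X^n ∣ hf (GG (3*s+3)) i j - yc s i j := by
    intro n
    induction n with
    | zero => intro s i j; simp
    | succ n ih =>
      have a1 : ∀ s i j, X^(n+1) ∣ (hf (GG (3*s+3)) i j - yc s i j) -
          (hf (GG (3*(s+1)+2)) i j - xc (s+1) i j) := by
        intro s i j
        obtain ⟨u, hu⟩ := (ih (s+1) i j).2
        obtain ⟨v, hv⟩ := (ih (s+2) (i-1) j).1
        refine ⟨X^(3*s+2) * u + X^(3*s+3) * (1 - X^(6*i)) * v, ?_⟩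
        linear_combination GG_recY s i j - xc_recY s i j + X^(3*s+3) * hu +
          X^(3*s+4) * (1 - X^(6*i)) * hv
      have a2 : ∀ s i j, X^(n+1) ∣ (hf (GG (3*s+2)) i j - xc s i j) -
          (hf (GG (3*s+3)) i j - yc s i j) := by
        intro s i j
        obtain ⟨u, hu⟩ := (ih (s+1) i (j-1)).2
        obtain ⟨v, hv⟩ := (ih (s+2) (i-1) (j-1)).1
        refine ⟨X^(3*s+1) * (1 - X^(6*j)) * u +
          X^(6*s+5) * (1 - X^(6*i)) * (1 - X^(6*j)) * v, ?_⟩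
        linear_combination GG_recX s i j - xc_recX s i j + X^(3*s+2) * (1 - X^(6*j)) * hu +
          X^(6*s+6) * (1 - X^(6*i)) * (1 - X^(6*j)) * hv
      have a3 : ∀ t s i j, X^(n+1) ∣ (hf (GG (3*s+2)) i j - xc s i j) -
          (hf (GG (3*(s+t)+2)) i j - xc (s+t) i j) := by
        intro t
        induction t with
        | zero => intro s i j; simp
        | succ t iht =>
          intro s i j
          have := dvd_add (iht s i j) (dvd_add (a2 (s+t) i j) (a1 (s+t) i j))
          rw [← add_assoc]
          convert this using 1
          ring
      have a4 : ∀ s i j, X^(n+1) ∣ hf (GG (3*s+2)) i j - xc s i j := by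
        intro s i j
        have := dvd_add (a3 (n+1) s i j)
          ((pow_dvd_pow X (show n + 1 ≤ s + (n+1) by omega)).trans (base_G (s+(n+1)) i j))
        simpa using this
      intro s i j
      refine ⟨a4 s i j, ?_⟩
      have := dvd_add (a1 s i j) (a4 (s+1) i j)
      simpa using this
  exact sub_eq_zero.1 (eq_zero_of_dvd fun n => (key n s i j).1)

/-- candidate for the distinct side -/
noncomputable def pc (s i j : ℕ) : PowerSeries ℤ :=
  EE (2*s) * X ^ (6*s*(i+j) + (3*i^2+i) + bexp j)

lemma pc_rec (s i j : ℕ) : pc s i j = (1 + X^(6*s+3)) * (1 + X^(6*s+6)) *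
    (pc (s+1) i j + X^(6*s+2) * (1 - X^(6*j)) * pc (s+1) i (j-1)
      + X^(6*s+4) * (1 - X^(6*i)) * pc (s+1) (i-1) j
      + X^(12*s+6) * (1 - X^(6*i)) * (1 - X^(6*j)) * pc (s+1) (i-1) (j-1)) := by
  unfold pc
  have e1 : 2 * (s+1) = 2*s+1+1 := by ring
  rw [EE_rec (2*s), EE_rec (2*s+1), e1]
  rcases i with _ | i <;> rcases j with _ | j <;>
    simp only [bexp, Nat.add_sub_cancel] <;> ring

lemma base_P (s i j : ℕ) : X^s ∣ hf (PP (6*s+1)) i j - pc s i j := by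
  have hG : ∀ t ∈ PP (6*s+1), ∀ x ∈ t, 6*s+1 ≤ x := fun t ht x hx => (ht x hx).1
  by_cases h : i + j = 0
  · obtain ⟨rfl, rfl⟩ : i = 0 ∧ j = 0 := by omega
    have h1 := (pow_dvd_pow X (show s ≤ 6*s+1 by omega)).trans
      (hf_dvd0 hG (by simp [mem_PP]))
    have h2 := (pow_dvd_pow X (show s ≤ 2*s by omega)).trans (EE_dvd (2*s))
    have h3 : pc s 0 0 = EE (2*s) := by simp [pc, bexp]
    rw [h3]
    have := dvd_sub h1 h2
    simpa using this
  · apply dvd_sub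
    · exact (pow_dvd_pow X (show s ≤ 6*s+1 by omega)).trans (hf_dvd hG i j h)
    · unfold pc
      apply Dvd.dvd.mul_left
      apply pow_dvd_pow
      have : s * 1 ≤ s * (i + j) := Nat.mul_le_mul_left _ (by omega)
      nlinarith

lemma hf_PP (s i j : ℕ) : hf (PP (6*s+1)) i j = pc s i j := by
  have key : ∀ n, ∀ s i j, X^n ∣ hf (PP (6*s+1)) i j - pc s i j := by
    intro n
    induction n with
    | zero => intro s i j; simp
    | succ n ih =>
      have a1 : ∀ s i j, X^(n+1) ∣ (hf (PP (6*s+1)) i j - pc s i j) -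
          (hf (PP (6*(s+1)+1)) i j - pc (s+1) i j) := by
        intro s i j
        obtain ⟨u, hu⟩ := ih (s+1) i j
        obtain ⟨v, hv⟩ := ih (s+1) i (j-1)
        obtain ⟨w, hw⟩ := ih (s+1) (i-1) j
        obtain ⟨z, hz⟩ := ih (s+1) (i-1) (j-1)
        refine ⟨(X^(6*s+2) + X^(6*s+5) + X^(12*s+8)) * u + (1 + X^(6*s+3)) * (1 + X^(6*s+6)) *
          (X^(6*s+1) * (1 - X^(6*j)) * v + X^(6*s+3) * (1 - X^(6*i)) * w
            + X^(12*s+5) * (1 - X^(6*i)) * (1 - X^(6*j)) * z), ?_⟩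
        linear_combination PP_rec s i j - pc_rec s i j +
          (X^(6*s+3) + X^(6*s+6) + X^(12*s+9)) * hu + (1 + X^(6*s+3)) * (1 + X^(6*s+6)) *
          (X^(6*s+2) * (1 - X^(6*j)) * hv + X^(6*s+4) * (1 - X^(6*i)) * hw
            + X^(12*s+6) * (1 - X^(6*i)) * (1 - X^(6*j)) * hz)
      have a3 : ∀ t s i j, X^(n+1) ∣ (hf (PP (6*s+1)) i j - pc s i j) -
          (hf (PP (6*(s+t)+1)) i j - pc (s+t) i j) := by
        intro t
        induction t with
        | zero => intro s i j; simp
        | succ t iht =>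
          intro s i j
          have := dvd_add (iht s i j) (a1 (s+t) i j)
          rw [← add_assoc]
          convert this using 1
          ring
      intro s i j
      have := dvd_add (a3 (n+1) s i j)
        ((pow_dvd_pow X (show n + 1 ≤ s + (n+1) by omega)).trans (base_P (s+(n+1)) i j))
      simpa using this
  exact sub_eq_zero.1 (eq_zero_of_dvd fun n => key n s i j)

lemma Dp_ne (i : ℕ) : Dp i ≠ 0 := by
  unfold Dp
  rw [Finset.prod_ne_zero_iff]
  intro t _ h
  have := congrArg (coeff 0) h
  rw [map_sub, coeff_X_pow] at this
  simp at this

lemma gf_eq (i j : ℕ) : gf (PP 1) i j = gf (GG 2) i j := by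
  have h1 := hf_GG 0 i j
  have h2 := hf_PP 0 i j
  have h3 : xc 0 i j = pc 0 i j := by
    unfold xc pc
    have := MM_EE (i+j)
    simp only [zero_add, mul_zero, zero_mul]
    rw [← this]; ring
  rw [h3, ← h2] at h1
  unfold hf at h1
  exact (mul_left_cancel₀ (mul_ne_zero (Dp_ne i) (Dp_ne j)) h1).symm

lemma total_eq (n : ℕ) : {s | s ∈ PP 1 ∧ ∑ x ∈ s, x = n}.ncard =
    {s | s ∈ GG 2 ∧ ∑ x ∈ s, x = n}.ncard := by
  have f1 : {s | s ∈ PP 1 ∧ ∑ x ∈ s, x = n}.Finite := (sum_finite n).subset fun s hs => hs.2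
  have f2 : {s | s ∈ GG 2 ∧ ∑ x ∈ s, x = n}.Finite := (sum_finite n).subset fun s hs => hs.2
  rw [Set.ncard_eq_toFinset_card _ f1, Set.ncard_eq_toFinset_card _ f2]
  let f : Finset ℕ → ℕ × ℕ := fun s => (cnt 1 s, cnt 2 s)
  rw [Finset.card_eq_sum_card_fiberwise (f := f) (t := f1.toFinset.image f ∪ f2.toFinset.image f),
    Finset.card_eq_sum_card_fiberwise (s := f2.toFinset) (f := f)
      (t := f1.toFinset.image f ∪ f2.toFinset.image f)]
  · apply Finset.sum_congr rfl
    rintro ⟨i, j⟩ -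
    have h := congrArg (coeff n) (gf_eq i j)
    simp only [gf, coeff_mk, Nat.cast_inj] at h
    have g : ∀ (A : Set (Finset ℕ)) (fA : {s | s ∈ A ∧ ∑ x ∈ s, x = n}.Finite),
        (fA.toFinset.filter (fun s => f s = (i, j))).card = (cls A i j n).ncard := by
      intro A fA
      rw [← Set.ncard_coe_finset]
      congr 1
      ext s
      simp [cls, f, and_assoc]
    rw [g, g, h]
  · intro s hs
    exact Finset.mem_coe.2 (Finset.mem_union_right _ (Finset.mem_image_of_mem _ hs))
  · intro s hs
    exact Finset.mem_coe.2 (Finset.mem_union_left _ (Finset.mem_image_of_mem _ hs))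

lemma card_part (n : ℕ) (A : Set (Finset ℕ)) (Q : n.Partition → Prop)
    (hA : ∀ s ∈ A, ∀ x ∈ s, 0 < x) (hQ : ∀ p, Q p → p.parts.Nodup)
    (h : ∀ (p : n.Partition) (hp : p.parts.Nodup), Q p ↔ (⟨p.parts, hp⟩ : Finset ℕ) ∈ A) :
    Nat.card {p : n.Partition // Q p} = {s | s ∈ A ∧ ∑ x ∈ s, x = n}.ncard := by
  rw [← Nat.card_coe_set_eq]
  refine Nat.card_congr
    { toFun := fun p => ⟨⟨p.1.parts, hQ p.1 p.2⟩, (h p.1 (hQ p.1 p.2)).1 p.2, ?_⟩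
      invFun := fun s => ⟨⟨s.1.val, fun {i} hi => hA s.1 s.2.1 i hi, ?_⟩, ?_⟩
      left_inv := ?_
      right_inv := ?_ }
  · change (Multiset.map (fun x => x) p.1.parts).sum = n
    rw [Multiset.map_id']
    exact p.1.parts_sum
  · have := s.2.2
    change (Multiset.map (fun x => x) s.1.val).sum = n at this
    rwa [Multiset.map_id'] at this
  · rw [h _ s.1.nodup]
    exact s.2.1
  · intro p; rfl
  · intro s; rfl

lemma gap_trans : ∀ {a b c : ℕ}, CapparelliGap a b → CapparelliGap b c → CapparelliGap a c := by
  intro a b c h1 h2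
  unfold CapparelliGap at *
  omega

instance : IsTrans ℕ CapparelliGap := ⟨fun _ _ _ => gap_trans⟩

lemma chain_iff (s : Multiset ℕ) : (s.sort (· ≤ ·)).IsChain CapparelliGap ↔
    s.Nodup ∧ ∀ x ∈ s, ∀ y ∈ s, x < y → CapparelliGap x y := by
  rw [List.isChain_iff_pairwise]
  have hs : (s.sort (· ≤ ·)).Pairwise (· ≤ ·) := Multiset.pairwise_sort s (· ≤ ·)
  have hc : ((s.sort (· ≤ ·) : List ℕ) : Multiset ℕ) = s := Multiset.sort_eq s (· ≤ ·)
  have hm : ∀ x, x ∈ s ↔ x ∈ s.sort (· ≤ ·) := fun x => by simp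
  have hn : s.Nodup ↔ (s.sort (· ≤ ·)).Nodup := by
    rw [← Multiset.coe_nodup, hc]
  rw [hn]
  simp only [hm]
  generalize s.sort (· ≤ ·) = l at hs
  clear hm hn hc
  induction l with
  | nil => simp
  | cons a l ih =>
    rw [List.pairwise_cons] at hs
    have ih' : l.Pairwise CapparelliGap ↔
      l.Nodup ∧ ∀ x ∈ l, ∀ y ∈ l, x < y → CapparelliGap x y := ih hs.2
    rw [List.pairwise_cons, ih', List.nodup_cons]
    constructor
    · rintro ⟨h1, h2, h3⟩
      refine ⟨⟨fun ha => ?_, h2⟩, ?_⟩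
      · have := h1 a ha
        unfold CapparelliGap at this; omega
      · intro x hx y hy hxy
        rw [List.mem_cons] at hx hy
        rcases hx with rfl | hx <;> rcases hy with rfl | hy
        · omega
        · exact h1 y hy
        · have := hs.1 x hx; omega
        · exact h3 x hx y hy hxy
    · rintro ⟨⟨h1, h2⟩, h3⟩
      refine ⟨fun y hy => ?_, h2, fun x hx y hy => h3 x (by simp [hx]) y (by simp [hy])⟩
      refine h3 a (by simp) y (by simp [hy]) ?_
      rcases (hs.1 y hy).eq_or_lt with rfl | h
      · exact absurd hy h1
      · exact h

end Capp

theorem statement8 (n : ℕ) :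
    Nat.card {p : n.Partition //
      p.parts.Nodup ∧ ∀ a ∈ p.parts, ¬(a % 6 = 1 ∨ a % 6 = 5)} =
    Nat.card {p : n.Partition //
      (∀ a ∈ p.parts, 2 ≤ a) ∧ (p.parts.sort (· ≤ ·)).Chain' CapparelliGap} := by
  rw [Capp.card_part n (Capp.PP 1), Capp.card_part n (Capp.GG 2), Capp.total_eq]
  · intro s hs x hx
    have := hs.1 x hx
    omega
  · rintro p ⟨-, h2⟩
    exact ((Capp.chain_iff _).1 h2).1
  · intro p hp
    refine (and_congr_right fun _ => Capp.chain_iff _).trans ?_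
    rw [Capp.mem_GG]
    simp only [Finset.mem_mk]
    tauto
  · intro s hs x hx
    exact (hs x hx).1
  · rintro p ⟨h, -⟩
    exact h
  · intro p hp
    rw [Capp.mem_PP]
    simp only [Finset.mem_mk]
    exact ⟨fun h x hx => ⟨p.parts_pos hx, h.2 x hx⟩, fun h => ⟨hp, fun x hx => (h x hx).2⟩⟩
end

section
/- Capparelli's second identity: for every nonnegative integer n, the number of partitions of n into distinct parts, none congruent to 2 or 4 modulo 6, equals the number of partitions c₁ ≥ c₂ ≥ ⋯ ≥ c_s of n such that no part equals 2, c_j − c_{j+1} ≥ 2 for all 1 ≤ j < s, and whenever c_j − c_{j+1} equals 2 or 3 one has either c_j + c_{j+1} ≡ 0 (mod 6) or both c_j ≡ 0 (mod 3) and c_{j+1} ≡ 0 (mod 3). -/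
section alg
variable {K : Type*} [CommRing K]

/-- Inverse of `1 - x` for `x ^ N = 0`. -/
def capGeom (N : ℕ) (x : K) : K := ∑ t ∈ Finset.range N, x ^ t

lemma capGeom_mul {N : ℕ} {x : K} (hx : x ^ N = 0) : (1 - x) * capGeom N x = 1 := by
  unfold capGeom
  rw [mul_neg_geom_sum, hx, sub_zero]

lemma cap_pow_zero {q : K} {N : ℕ} (hq : q ^ N = 0) (k : ℕ) (hk : N ≤ k) : q ^ k = 0 := by
  obtain ⟨d, rfl⟩ := Nat.exists_eq_add_of_le hk
  rw [pow_add, hq, zero_mul]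

/-- `q^(3i²-2i) / (q⁶;q⁶)_i` -/
def capA (q : K) (N : ℕ) : ℕ → K
  | 0 => 1
  | i + 1 => q ^ (6 * i + 1) * capA q N i * capGeom N (q ^ (6 * i + 6))

/-- `q^(3j²-j) / (q⁶;q⁶)_j` -/
def capB (q : K) (N : ℕ) : ℕ → K
  | 0 => 1
  | j + 1 => q ^ (6 * j + 2) * capB q N j * capGeom N (q ^ (6 * j + 6))

/-- `(-q^(3k+3);q³)_∞` -/
def capL (q : K) (N : ℕ) (k : ℕ) : K := ∏ l ∈ Finset.range (2 * N), (1 + q ^ (3 * (k + l) + 3))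

/-- `(-1;q³)_m / 2` -/
def capM (q half : K) : ℕ → K
  | 0 => half
  | m + 1 => (1 + q ^ (3 * m)) * capM q half m

variable {q half : K} {N : ℕ}

lemma capA_succ (hq : q ^ N = 0) (i : ℕ) :
    capA q N (i + 1) * (1 - q ^ (6 * i + 6)) = q ^ (6 * i + 1) * capA q N i := by
  have h := capGeom_mul (N := N) (x := q ^ (6 * i + 6))
    (by rw [← pow_mul, mul_comm, pow_mul, hq, zero_pow (by omega)])
  rw [capA]
  linear_combination (q ^ (6 * i + 1) * capA q N i) * h

lemma capB_succ (hq : q ^ N = 0) (i : ℕ) :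
    capB q N (i + 1) * (1 - q ^ (6 * i + 6)) = q ^ (6 * i + 2) * capB q N i := by
  have h := capGeom_mul (N := N) (x := q ^ (6 * i + 6))
    (by rw [← pow_mul, mul_comm, pow_mul, hq, zero_pow (by omega)])
  rw [capB]
  linear_combination (q ^ (6 * i + 2) * capB q N i) * h

lemma capA_dvd (i : ℕ) : q ^ i ∣ capA q N i := by
  induction i with
  | zero => simp
  | succ i ih =>
    obtain ⟨c, hc⟩ := ih
    rw [capA, hc]
    exact ⟨q ^ (6 * i) * c * capGeom N (q ^ (6 * i + 6)), by ring⟩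

lemma capB_dvd (i : ℕ) : q ^ i ∣ capB q N i := by
  induction i with
  | zero => simp
  | succ i ih =>
    obtain ⟨c, hc⟩ := ih
    rw [capB, hc]
    exact ⟨q ^ (6 * i + 1) * c * capGeom N (q ^ (6 * i + 6)), by ring⟩

lemma capA_N (hq : q ^ N = 0) : capA q N N = 0 := by
  have := capA_dvd (q := q) (N := N) N
  rwa [hq, zero_dvd_iff] at this

lemma capB_N (hq : q ^ N = 0) : capB q N N = 0 := by
  have := capB_dvd (q := q) (N := N) N
  rwa [hq, zero_dvd_iff] at this

lemma capL_succ (hq : q ^ N = 0) (k : ℕ) :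
    capL q N k = (1 + q ^ (3 * k + 3)) * capL q N (k + 1) := by
  have h := Finset.prod_range_succ (fun l => (1 + q ^ (3 * (k + l) + 3))) (2 * N)
  have h' := Finset.prod_range_succ' (fun l => (1 + q ^ (3 * (k + l) + 3))) (2 * N)
  rw [cap_pow_zero hq (3 * (k + 2 * N) + 3) (by omega), add_zero, mul_one] at h
  unfold capL
  rw [← h, h', mul_comm]
  congr 1
  refine Finset.prod_congr rfl fun l _ => ?_
  congr 2
  ring

lemma capL_one (hq : q ^ N = 0) (k : ℕ) (hk : N ≤ k) : capL q N k = 1 := by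
  unfold capL
  refine Finset.prod_eq_one fun l _ => ?_
  rw [cap_pow_zero hq _ (by omega), add_zero]

/-- the common factor -/
def capH (q half : K) (N s i j : ℕ) : K :=
  q ^ (3 * s * (i + j)) * capA q N i * capB q N j * capL q N (i + j + s) * capM q half (i + j)

def capX (q half : K) (N s i j : ℕ) : K := (q ^ (3 * j) + q ^ (3 * i)) * capH q half N s i j
def capY (q half : K) (N s i j : ℕ) : K :=
  q ^ (3 * i) * (1 + q ^ (3 * (i + j))) * capH q half N s i j
def capZ (q half : K) (N s i j : ℕ) : K :=
  q ^ (3 * (i + j)) * (q ^ (3 * j) + q ^ (3 * i)) * capH q half N s i j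
def capG (q half : K) (N i j : ℕ) : K :=
  q ^ (3 * j) * (1 + q ^ (3 * (i + j))) * capH q half N 0 i j

lemma capX_zero (s j : ℕ) : capX q half N s 0 j = capY q half N s 0 j := by
  unfold capX capY
  simp only [zero_add]
  ring

lemma capX_succ (hq : q ^ N = 0) (s i j : ℕ) : capX q half N s (i + 1) j =
    capY q half N s (i + 1) j + q ^ (3 * s + 1) * capY q half N (s + 1) i j := by
  have h := capA_succ hq i
  unfold capX capY capH
  rw [show i + 1 + j = i + j + 1 by ring, show i + j + (s + 1) = i + j + 1 + s by ring, capM]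
  linear_combination (q ^ (3 * j) * q ^ (3 * s * (i + j + 1)) * capB q N j *
    capL q N (i + j + 1 + s) * (1 + q ^ (3 * (i + j))) * capM q half (i + j)) * h

lemma capG_zero (j : ℕ) : capG q half N 0 j = capZ q half N 0 0 j := by
  unfold capG capZ
  simp only [zero_add]
  ring

lemma capG_succ (hq : q ^ N = 0) (i j : ℕ) : capG q half N (i + 1) j =
    capZ q half N 0 (i + 1) j + q * capY q half N 1 i j := by
  have h := capA_succ hq i
  unfold capG capZ capY capH
  rw [show i + 1 + j = i + j + 1 by ring, add_zero, capM]
  linear_combination (q ^ (3 * j) * capB q N j *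
    capL q N (i + j + 1) * (1 + q ^ (3 * (i + j))) * capM q half (i + j)) * h

lemma capZ_eq (hq : q ^ N = 0) (s i j : ℕ) : capZ q half N s i j =
    capX q half N (s + 1) i j + q ^ (3 * s + 3) * capZ q half N (s + 1) i j := by
  have h := capL_succ hq (i + j + s)
  unfold capX capZ capH
  rw [show i + j + (s + 1) = i + j + s + 1 by ring, h]
  ring

lemma capY_i0 (s i : ℕ) : capY q half N s i 0 = capZ q half N s i 0 := by
  unfold capY capZ
  ring

lemma capY_0j (hq : q ^ N = 0) (s j : ℕ) : capY q half N s 0 (j + 1) =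
    capZ q half N s 0 (j + 1) + q ^ (3 * s + 2) * capZ q half N (s + 1) 0 j := by
  have h := capB_succ hq j
  unfold capZ capY capH
  simp only [zero_add]
  rw [show j + (s + 1) = j + 1 + s by ring, capM]
  linear_combination (q ^ (3 * s * (j + 1)) * capA q N 0 *
    capL q N (j + 1 + s) * (1 + q ^ (3 * j)) * capM q half j) * h

lemma capY_ij (hq : q ^ N = 0) (s i j : ℕ) : capY q half N s (i + 1) (j + 1) =
    capZ q half N s (i + 1) (j + 1) + q ^ (3 * s + 2) * capZ q half N (s + 1) (i + 1) j
    + q ^ (6 * s + 6) * capY q half N (s + 2) i j := by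
  have h := capB_succ hq j
  have h' := capA_succ hq i
  unfold capZ capY capH
  rw [show i + 1 + (j + 1) = i + j + 1 + 1 by ring, show i + 1 + j = i + j + 1 by ring,
    show i + j + 1 + (s + 1) = i + j + 1 + 1 + s by ring,
    show i + j + (s + 2) = i + j + 1 + 1 + s by ring, capM, capM]
  linear_combination (q ^ (3 * (i + 1)) * q ^ (3 * s * (i + j + 1 + 1)) * capA q N (i + 1) *
    capL q N (i + j + 1 + 1 + s) * (1 + q ^ (3 * (i + j + 1))) * (1 + q ^ (3 * (i + j))) *
    capM q half (i + j)) * h +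
    (q ^ (3 * s * (i + j + 2)) * q ^ (3 * i + 6 * j + 5) * capB q N j *
    capL q N (i + j + 1 + 1 + s) * (1 + q ^ (3 * (i + j))) *
    capM q half (i + j)) * h'

lemma cap_sum_shift (f p r : ℕ → K) (n : ℕ) (h0 : f 0 = p 0)
    (hs : ∀ i, f (i + 1) = p (i + 1) + r i) (hr : r n = 0) :
    ∑ i ∈ Finset.range (n + 1), f i =
      ∑ i ∈ Finset.range (n + 1), p i + ∑ i ∈ Finset.range (n + 1), r i := by
  rw [Finset.sum_range_succ', Finset.sum_range_succ' p, Finset.sum_range_succ r, hr, h0]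
  simp only [hs, Finset.sum_add_distrib]
  ring

/-- double sum -/
def capS (N : ℕ) (f : ℕ → ℕ → K) : K :=
  ∑ i ∈ Finset.range (N + 1), ∑ j ∈ Finset.range (N + 1), f i j

lemma capS_add (f g : ℕ → ℕ → K) :
    capS N (fun i j => f i j + g i j) = capS N f + capS N g := by
  simp [capS, Finset.sum_add_distrib]

lemma capS_mul (c : K) (f : ℕ → ℕ → K) :
    capS N (fun i j => c * f i j) = c * capS N f := by
  simp [capS, Finset.mul_sum]

lemma capS_comm (f : ℕ → ℕ → K) : capS N f = capS N (fun i j => f j i) := by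
  unfold capS
  rw [Finset.sum_comm]

lemma capS_shift (f p r : ℕ → ℕ → K) (h0 : ∀ j, f 0 j = p 0 j)
    (hs : ∀ i j, f (i + 1) j = p (i + 1) j + r i j) (hr : ∀ j, r N j = 0) :
    capS N f = capS N p + capS N r := by
  rw [capS_comm f, capS_comm p, capS_comm r]
  unfold capS
  rw [← Finset.sum_add_distrib]
  refine Finset.sum_congr rfl fun j _ => ?_
  exact cap_sum_shift (fun i => f i j) (fun i => p i j) (fun i => r i j) N (h0 j)
    (fun i => hs i j) (hr j)

lemma capH_Nj (hq : q ^ N = 0) (s j : ℕ) : capH q half N s N j = 0 := by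
  simp [capH, capA_N hq]

lemma capH_iN (hq : q ^ N = 0) (s i : ℕ) : capH q half N s i (N + 1) = 0 := by
  simp [capH, capB, capB_N hq]

lemma capSX (hq : q ^ N = 0) (s : ℕ) : capS N (capX q half N s) =
    capS N (capY q half N s) + q ^ (3 * s + 1) * capS N (capY q half N (s + 1)) := by
  rw [← capS_mul]
  exact capS_shift _ _ _ (capX_zero s) (capX_succ hq s) (fun j => by simp [capY, capH_Nj hq])

lemma capSG (hq : q ^ N = 0) : capS N (capG q half N) =
    capS N (capZ q half N 0) + q * capS N (capY q half N 1) := by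
  rw [← capS_mul]
  exact capS_shift _ _ _ capG_zero (capG_succ hq) (fun j => by simp [capY, capH_Nj hq])

lemma capSZ (hq : q ^ N = 0) (s : ℕ) : capS N (capZ q half N s) =
    capS N (capX q half N (s + 1)) + q ^ (3 * s + 3) * capS N (capZ q half N (s + 1)) := by
  rw [← capS_mul, ← capS_add]
  congr 1
  funext i j
  exact capZ_eq hq s i j

lemma capSY (hq : q ^ N = 0) (s : ℕ) : capS N (capY q half N s) =
    capS N (capZ q half N s) + q ^ (3 * s + 2) * (capS N (capZ q half N (s + 1)) +
      q ^ (3 * s + 4) * capS N (capY q half N (s + 2))) := by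
  have h1 : capS N (capY q half N s) = capS N (capZ q half N s) +
      capS N (fun i j => capY q half N s i (j + 1) - capZ q half N s i (j + 1)) := by
    rw [capS_comm, capS_comm (capZ q half N s), capS_comm (fun i j => _ - _)]
    refine capS_shift _ _ _ (fun j => capY_i0 s j) (fun i j => by ring) (fun j => ?_)
    simp [capY, capZ, capH_iN hq]
  have h2 : capS N (fun i j => capY q half N s i (j + 1) - capZ q half N s i (j + 1)) =
      capS N (fun i j => q ^ (3 * s + 2) * capZ q half N (s + 1) i j) +
      capS N (fun i j => q ^ (6 * s + 6) * capY q half N (s + 2) i j) := by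
    refine capS_shift _ _ _ (fun j => ?_) (fun i j => ?_) (fun j => ?_)
    · rw [capY_0j hq]; ring
    · rw [capY_ij hq]; ring
    · simp [capY, capH_Nj hq]
  rw [h1, h2, capS_mul, capS_mul]
  ring

lemma capH_big (hq : q ^ N = 0) (s i j : ℕ) (hs : N ≤ s) (h : i + j ≠ 0) :
    capH q half N s i j = 0 := by
  unfold capH
  rw [cap_pow_zero hq (3 * s * (i + j)) (by nlinarith [Nat.pos_of_ne_zero h])]
  simp

lemma capS_single (f : ℕ → ℕ → K) (h : ∀ i j, i + j ≠ 0 → f i j = 0) : capS N f = f 0 0 := by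
  unfold capS
  rw [Finset.sum_eq_single 0, Finset.sum_eq_single 0]
  · intro j _ hj; exact h _ _ (by omega)
  · simp
  · intro i _ hi; exact Finset.sum_eq_zero fun j _ => h _ _ (by omega)
  · simp

lemma capH_00 (hq : q ^ N = 0) (s : ℕ) (hs : N ≤ s) : capH q half N s 0 0 = half := by
  simp [capH, capA, capB, capM, capL_one hq s hs]

lemma capSX_big (hq : q ^ N = 0) (hh : 2 * half = 1) (s : ℕ) (hs : N ≤ s) :
    capS N (capX q half N s) = 1 := by
  rw [capS_single _ (fun i j h => by simp [capX, capH_big hq s i j hs h])]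
  simp only [capX, capH_00 hq s hs]
  linear_combination hh

lemma capSY_big (hq : q ^ N = 0) (hh : 2 * half = 1) (s : ℕ) (hs : N ≤ s) :
    capS N (capY q half N s) = 1 := by
  rw [capS_single _ (fun i j h => by simp [capY, capH_big hq s i j hs h])]
  simp only [capY, capH_00 hq s hs]
  linear_combination hh

lemma capSZ_big (hq : q ^ N = 0) (hh : 2 * half = 1) (s : ℕ) (hs : N ≤ s) :
    capS N (capZ q half N s) = 1 := by
  rw [capS_single _ (fun i j h => by simp [capZ, capH_big hq s i j hs h])]
  simp only [capZ, capH_00 hq s hs]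
  linear_combination hh

/-- Uniqueness of the solution of the recurrences. -/
lemma cap_unique (hq : q ^ N = 0) (hh : 2 * half = 1) (FX FY FZ : ℕ → K)
    (hX : ∀ s, FX s = FY s + q ^ (3 * s + 1) * FY (s + 1))
    (hY : ∀ s, FY s = FZ s + q ^ (3 * s + 2) * (FZ (s + 1) + q ^ (3 * s + 4) * FY (s + 2)))
    (hZ : ∀ s, FZ s = FX (s + 1) + q ^ (3 * s + 3) * FZ (s + 1))
    (hX1 : ∀ s, N ≤ s → FX s = 1) (hY1 : ∀ s, N ≤ s → FY s = 1) (hZ1 : ∀ s, N ≤ s → FZ s = 1) :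
    FZ 0 + q * FY 1 = capS N (capG q half N) := by
  have key : ∀ d s, N ≤ s + d → FX s = capS N (capX q half N s) ∧
      FY s = capS N (capY q half N s) ∧ FZ s = capS N (capZ q half N s) := by
    intro d
    induction d with
    | zero =>
      intro s hs
      rw [hX1 s hs, hY1 s hs, hZ1 s hs, capSX_big hq hh s hs, capSY_big hq hh s hs,
        capSZ_big hq hh s hs]
      simp
    | succ d ih =>
      intro s hs
      obtain ⟨a1, b1, c1⟩ := ih (s + 1) (by omega)
      obtain ⟨a2, b2, c2⟩ := ih (s + 2) (by omega)
      have hz : FZ s = capS N (capZ q half N s) := by rw [hZ, capSZ hq, a1, c1]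
      have hy : FY s = capS N (capY q half N s) := by rw [hY, capSY hq, hz, c1, b2]
      exact ⟨by rw [hX, capSX hq, hy, b1], hy, hz⟩
  rw [capSG hq, (key N 0 (by omega)).2.2, (key N 1 (by omega)).2.1]

lemma capM_L (hq : q ^ N = 0) (hh : 2 * half = 1) (m : ℕ) :
    (1 + q ^ (3 * m)) * capM q half m * capL q N m = capL q N 0 := by
  induction m with
  | zero => simp only [capM]; linear_combination capL q N 0 * hh
  | succ m ih => rw [← ih, capM, capL_succ hq m]; ring

lemma cap_euler (hq : q ^ N = 0) (A : ℕ → K) (e : ℕ) (h0 : A 0 = 1) (hN : A N = 0)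
    (hA : ∀ i, A (i + 1) * (1 - q ^ (6 * i + 6)) = q ^ (6 * i + e) * A i) :
    ∑ i ∈ Finset.range (N + 1), A i = ∏ s ∈ Finset.range N, (1 + q ^ (6 * s + e)) := by
  have step : ∀ s, ∑ i ∈ Finset.range (N + 1), q ^ (6 * s * i) * A i =
      (1 + q ^ (6 * s + e)) * ∑ i ∈ Finset.range (N + 1), q ^ (6 * (s + 1) * i) * A i := by
    intro s
    rw [add_mul, one_mul, Finset.mul_sum]
    refine cap_sum_shift _ _ _ N (by simp) (fun i => ?_) (by simp [hN])
    linear_combination q ^ (6 * s * (i + 1)) * hA i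
  have all : ∀ k, ∑ i ∈ Finset.range (N + 1), A i = (∏ s ∈ Finset.range k, (1 + q ^ (6 * s + e))) *
      ∑ i ∈ Finset.range (N + 1), q ^ (6 * k * i) * A i := by
    intro k
    induction k with
    | zero => simp
    | succ k ih => rw [ih, Finset.prod_range_succ, step k]; ring
  rw [all N, Finset.sum_eq_single 0]
  · simp [h0]
  · intro i _ hi
    rw [cap_pow_zero hq _ (by nlinarith [Nat.pos_of_ne_zero hi]), zero_mul]
  · simp

lemma capG_prod (hq : q ^ N = 0) (hh : 2 * half = 1) : capS N (capG q half N) =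
    (∏ s ∈ Finset.range N, (1 + q ^ (6 * s + 1))) * (∏ s ∈ Finset.range N, (1 + q ^ (6 * s + 5))) *
    ∏ l ∈ Finset.range (2 * N), (1 + q ^ (3 * l + 3)) := by
  have hL : ∏ l ∈ Finset.range (2 * N), (1 + q ^ (3 * l + 3)) = capL q N 0 := by
    unfold capL; simp
  rw [← cap_euler hq (capA q N) 1 rfl (capA_N hq) (capA_succ hq),
    ← cap_euler hq (fun j => q ^ (3 * j) * capB q N j) 5 (by simp [capB]) (by simp [capB_N hq]) ?_,
    hL, Finset.sum_mul_sum, Finset.sum_mul]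
  · unfold capS
    refine Finset.sum_congr rfl fun i _ => ?_
    rw [Finset.sum_mul]
    refine Finset.sum_congr rfl fun j _ => ?_
    rw [← capM_L hq hh (i + j)]
    unfold capG capH
    simp only [mul_zero, zero_mul, pow_zero, add_zero]
    ring
  · intro j
    linear_combination q ^ (3 * j + 3) * capB_succ hq j

/-- parts allowed on the product side -/
def CapOk (x : ℕ) : Prop := x ≠ 0 ∧ ¬ (x % 6 = 2 ∨ x % 6 = 4)

instance : DecidablePred CapOk := fun x => by unfold CapOk; infer_instance

lemma cap_prod_blocks (k : ℕ) :
    ∏ x ∈ Finset.range (6 * k + 1), (if CapOk x then 1 + q ^ x else 1) =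
    (∏ s ∈ Finset.range k, (1 + q ^ (6 * s + 1))) * (∏ s ∈ Finset.range k, (1 + q ^ (6 * s + 5))) *
    ∏ l ∈ Finset.range (2 * k), (1 + q ^ (3 * l + 3)) := by
  induction k with
  | zero => simp [CapOk]
  | succ k ih =>
    rw [show 6 * (k + 1) + 1 = 6 * k + 1 + 1 + 1 + 1 + 1 + 1 + 1 by ring,
      show 2 * (k + 1) = 2 * k + 1 + 1 by ring]
    simp only [Finset.prod_range_succ _ (6 * k + 1 + 1 + 1 + 1 + 1 + 1),
      Finset.prod_range_succ _ (6 * k + 1 + 1 + 1 + 1 + 1),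
      Finset.prod_range_succ _ (6 * k + 1 + 1 + 1 + 1),
      Finset.prod_range_succ _ (6 * k + 1 + 1 + 1),
      Finset.prod_range_succ _ (6 * k + 1 + 1),
      Finset.prod_range_succ _ (6 * k + 1), Finset.prod_range_succ _ (2 * k + 1),
      Finset.prod_range_succ _ (2 * k), Finset.prod_range_succ _ k, ih]
    rw [if_pos (show CapOk (6 * k + 1) by unfold CapOk; omega),
      if_neg (show ¬ CapOk (6 * k + 1 + 1) by unfold CapOk; omega),
      if_pos (show CapOk (6 * k + 1 + 1 + 1) by unfold CapOk; omega),
      if_neg (show ¬ CapOk (6 * k + 1 + 1 + 1 + 1) by unfold CapOk; omega),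
      if_pos (show CapOk (6 * k + 1 + 1 + 1 + 1 + 1) by unfold CapOk; omega),
      if_pos (show CapOk (6 * k + 1 + 1 + 1 + 1 + 1 + 1) by unfold CapOk; omega)]
    ring

end alg

section comb
open Classical Finset

/-- pairwise version of the gap condition -/
def CapPW (s : Finset ℕ) : Prop := ∀ x ∈ s, ∀ y ∈ s, x < y → CapparelliGap x y

/-- generating function of gap sets with elements satisfying `T`, truncated at `M` -/
noncomputable def capF {K : Type*} [CommRing K] (q : K) (M : ℕ) (T : ℕ → Prop) : K :=
  ∑ s ∈ (range M).powerset with ((∀ x ∈ s, T x) ∧ CapPW s), q ^ (∑ x ∈ s, x)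

variable {K : Type*} [CommRing K] {q : K} {N : ℕ}

lemma capF_rec (hq : q ^ N = 0) (M : ℕ) (hM : N ≤ M) (r : ℕ) (T T' T'' : ℕ → Prop)
    (hr : T r) (hmin : ∀ x, T x → r ≤ x) (hT' : ∀ x, T' x ↔ T x ∧ x ≠ r)
    (hT'' : ∀ x, T'' x ↔ T x ∧ r < x ∧ CapparelliGap r x) :
    capF q M T = capF q M T' + q ^ r * capF q M T'' := by
  unfold capF
  rw [← sum_filter_add_sum_filter_not _ (fun s => r ∉ s)]
  congr 1
  · rw [filter_filter]
    refine sum_congr (filter_congr fun s _ => ?_) fun _ _ => rfl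
    simp only [hT']
    constructor
    · rintro ⟨⟨h1, h2⟩, h3⟩
      exact ⟨fun x hx => ⟨h1 x hx, fun h => h3 (h ▸ hx)⟩, h2⟩
    · rintro ⟨h1, h2⟩
      exact ⟨⟨fun x hx => (h1 x hx).1, h2⟩, fun h => (h1 r h).2 rfl⟩
  · by_cases hrM : r < M
    · rw [filter_filter, mul_sum]
      refine sum_nbij' (fun s => s.erase r) (fun s => insert r s) ?_ ?_ ?_ ?_ ?_
      · intro s hs
        simp only [mem_filter, mem_powerset, not_not] at hs ⊢
        obtain ⟨h0, ⟨h1, h2⟩, h3⟩ := hs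
        refine ⟨(erase_subset _ _).trans h0, fun x hx => ?_, fun x hx y hy => ?_⟩
        · have hx' := mem_erase.1 hx
          have hlt : r < x := lt_of_le_of_ne (hmin x (h1 x hx'.2)) (Ne.symm hx'.1)
          exact (hT'' x).2 ⟨h1 x hx'.2, hlt, h2 r h3 x hx'.2 hlt⟩
        · exact h2 x (mem_of_mem_erase hx) y (mem_of_mem_erase hy)
      · intro s hs
        simp only [mem_filter, mem_powerset, not_not] at hs ⊢
        obtain ⟨h0, h1, h2⟩ := hs
        refine ⟨insert_subset (mem_range.2 hrM) h0, ⟨fun x hx => ?_, fun x hx y hy hxy => ?_⟩,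
          mem_insert_self _ _⟩
        · rcases mem_insert.1 hx with rfl | hx
          · exact hr
          · exact ((hT'' x).1 (h1 x hx)).1
        · rcases mem_insert.1 hx with hxr | hx'
          · rcases mem_insert.1 hy with hyr | hy'
            · omega
            · rw [hxr]
              exact ((hT'' y).1 (h1 y hy')).2.2
          · rcases mem_insert.1 hy with hyr | hy'
            · have := ((hT'' x).1 (h1 x hx')).2.1
              omega
            · exact h2 x hx' y hy' hxy
      · intro s hs
        simp only [mem_filter, not_not] at hs
        exact insert_erase hs.2.2
      · intro s hs
        simp only [mem_filter] at hs
        exact erase_insert fun h => lt_irrefl r ((hT'' r).1 (hs.2.1 r h)).2.1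
      · intro s hs
        simp only [mem_filter, not_not] at hs
        rw [← pow_add, add_sum_erase s (fun x => x) hs.2.2]
    · rw [cap_pow_zero hq r (by omega), zero_mul]
      refine sum_eq_zero fun s hs => ?_
      simp only [mem_filter, mem_powerset, not_not] at hs
      exact absurd (mem_range.1 (hs.1.1 hs.2)) hrM

lemma capF_big (hq : q ^ N = 0) (M : ℕ) (T : ℕ → Prop) (hT : ∀ x, T x → N ≤ x) :
    capF q M T = 1 := by
  unfold capF
  rw [sum_eq_single ∅]
  · simp
  · intro s hs hne
    simp only [mem_filter, mem_powerset] at hs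
    obtain ⟨x, hx⟩ := nonempty_iff_ne_empty.2 hne
    have h2 := hT x (hs.2.1 x hx)
    exact cap_pow_zero hq _ (h2.trans (single_le_sum (f := fun x => x) (fun _ _ => Nat.zero_le _) hx))
  · intro h
    exact absurd (mem_filter.2 ⟨by simp, by simp [CapPW]⟩) h

lemma capF_total (hq : q ^ N = 0) (half : K) (hh : 2 * half = 1) :
    capF q (6 * N + 1) (fun x => x = 1 ∨ 3 ≤ x) =
    ∑ s ∈ (range (6 * N + 1)).powerset with (∀ x ∈ s, CapOk x), q ^ (∑ x ∈ s, x) := by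
  have hM : N ≤ 6 * N + 1 := by omega
  have hR : ∑ s ∈ (range (6 * N + 1)).powerset with (∀ x ∈ s, CapOk x), q ^ (∑ x ∈ s, x) =
      ∏ x ∈ range (6 * N + 1), (if CapOk x then 1 + q ^ x else 1) := by
    rw [← prod_filter, prod_one_add]
    refine sum_congr ?_ fun s _ => by rw [prod_pow_eq_pow_sum]
    ext s
    simp only [mem_filter, mem_powerset, subset_iff]
    constructor
    · rintro ⟨h1, h2⟩ x hx
      exact ⟨h1 hx, h2 x hx⟩
    · intro h
      exact ⟨fun x hx => (h hx).1, fun x hx => (h hx).2⟩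
  rw [hR, cap_prod_blocks, ← capG_prod hq hh,
    ← cap_unique hq hh (fun s => capF q (6 * N + 1) (fun x => 3 * s + 1 ≤ x))
      (fun s => capF q (6 * N + 1) (fun x => 3 * s + 2 ≤ x))
      (fun s => capF q (6 * N + 1) (fun x => 3 * s + 3 ≤ x))]
  · have h := capF_rec hq (6 * N + 1) hM 1 (fun x => x = 1 ∨ 3 ≤ x) (fun x => 3 * 0 + 3 ≤ x)
      (fun x => 3 * 1 + 2 ≤ x) (by omega) (by intro x; omega) (by intro x; omega)
      (by intro x; unfold CapparelliGap; omega)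
    rw [h, pow_one]
  · intro s
    exact capF_rec hq (6 * N + 1) hM (3 * s + 1) _ _ _ (by omega) (by intro x; omega)
      (by intro x; omega) (by intro x; unfold CapparelliGap; omega)
  · intro s
    have h1 := capF_rec hq (6 * N + 1) hM (3 * s + 2) (fun x => 3 * s + 2 ≤ x)
      (fun x => 3 * s + 3 ≤ x) (fun x => x = 3 * s + 4 ∨ 3 * (s + 1) + 3 ≤ x)
      (by omega) (by intro x; omega)
      (by intro x; omega) (by intro x; unfold CapparelliGap; omega)
    have h2 := capF_rec hq (6 * N + 1) hM (3 * s + 4) (fun x => x = 3 * s + 4 ∨ 3 * (s + 1) + 3 ≤ x)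
      (fun x => 3 * (s + 1) + 3 ≤ x) (fun x => 3 * (s + 2) + 2 ≤ x)
      (by omega) (by intro x; omega)
      (by intro x; omega) (by intro x; unfold CapparelliGap; omega)
    rw [h1, h2]
  · intro s
    exact capF_rec hq (6 * N + 1) hM (3 * s + 3) _ _ _ (by omega) (by intro x; omega)
      (by intro x; omega) (by intro x; unfold CapparelliGap; omega)
  · intro s hs
    exact capF_big hq _ _ (by intro x; omega)
  · intro s hs
    exact capF_big hq _ _ (by intro x; omega)
  · intro s hs
    exact capF_big hq _ _ (by intro x; omega)

lemma cap_count (n : ℕ) :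
    #{s ∈ (range (6 * (n + 1) + 1)).powerset | (∀ x ∈ s, CapOk x) ∧ ∑ x ∈ s, x = n} =
    #{s ∈ (range (6 * (n + 1) + 1)).powerset |
      ((∀ x ∈ s, x = 1 ∨ 3 ≤ x) ∧ CapPW s) ∧ ∑ x ∈ s, x = n} := by
  let I : Ideal (PowerSeries ℚ) := Ideal.span {(PowerSeries.X : PowerSeries ℚ) ^ (n + 1)}
  let π := Ideal.Quotient.mk I
  have hq : (π PowerSeries.X) ^ (n + 1) = 0 := by
    rw [← map_pow]
    exact Ideal.Quotient.eq_zero_iff_mem.2 (Ideal.mem_span_singleton_self _)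
  have hh : 2 * π (PowerSeries.C (1 / 2 : ℚ)) = 1 := by
    rw [show (2 : PowerSeries ℚ ⧸ I) = π (PowerSeries.C (2 : ℚ)) by rw [map_ofNat, map_ofNat], ← map_mul, ← map_mul]
    norm_num
  have h := capF_total hq _ hh
  unfold capF at h
  simp only [← map_pow] at h
  rw [← map_sum, ← map_sum, Ideal.Quotient.eq, Ideal.mem_span_singleton,
    PowerSeries.X_pow_dvd_iff] at h
  have h := h n (Nat.lt_succ_self n)
  rw [map_sub, map_sum, map_sum, sub_eq_zero] at h
  simp only [PowerSeries.coeff_X_pow, eq_comm (a := n)] at h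
  rw [sum_boole, sum_boole, filter_filter, filter_filter] at h
  exact_mod_cast h.symm

lemma cap_card (n M : ℕ) (hM : n < M) (P : n.Partition → Prop) (C : Finset ℕ → Prop)
    (hP : ∀ p, P p ↔ p.parts.Nodup ∧ C p.parts.toFinset) (hC : ∀ s, C s → 0 ∉ s) :
    Nat.card {p : n.Partition // P p} =
      #{s ∈ (range M).powerset | C s ∧ ∑ x ∈ s, x = n} := by
  rw [← Nat.card_eq_finsetCard]
  refine Nat.card_eq_of_bijective (fun p => ⟨p.1.parts.toFinset, ?_⟩) ⟨?_, ?_⟩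
  · obtain ⟨p, hp⟩ := p
    obtain ⟨h1, h2⟩ := (hP p).1 hp
    simp only [mem_filter, mem_powerset]
    refine ⟨fun x hx => ?_, h2, ?_⟩
    · have := Nat.Partition.le_of_mem_parts (Multiset.mem_toFinset.1 hx)
      exact mem_range.2 (by omega)
    · have h := p.parts_sum
      rw [Finset.sum_eq_multiset_sum, Multiset.toFinset_val, h1.dedup, Multiset.map_id']
      exact h
  · rintro ⟨p, hp⟩ ⟨p', hp'⟩ h
    have h := congrArg Finset.val (congrArg Subtype.val h)
    simp only [Multiset.toFinset_val, ((hP p).1 hp).1.dedup, ((hP p').1 hp').1.dedup] at h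
    exact Subtype.ext (Nat.Partition.ext h)
  · rintro ⟨s, hs⟩
    simp only [mem_filter, mem_powerset] at hs
    obtain ⟨h0, h1, h2⟩ := hs
    have hsf : s.val.toFinset = s := by simp
    refine ⟨⟨⟨s.val, fun {i} hi => Nat.pos_of_ne_zero fun h => hC s h1 (h ▸ hi), ?_⟩, ?_⟩, ?_⟩
    · rw [← h2, Finset.sum_eq_multiset_sum, Multiset.map_id']
    · rw [hP]
      exact ⟨s.nodup, by rw [hsf]; exact h1⟩
    · exact Subtype.ext hsf

lemma cap_chain (m : Multiset ℕ) : (m.sort (· ≤ ·)).IsChain CapparelliGap ↔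
    m.Nodup ∧ CapPW m.toFinset := by
  have ht : ∀ a b c, CapparelliGap a b → CapparelliGap b c → CapparelliGap a c := by
    intro a b c
    unfold CapparelliGap
    omega
  have : IsTrans ℕ CapparelliGap := ⟨ht⟩
  rw [List.isChain_iff_pairwise]
  constructor
  · intro h
    constructor
    · rw [← Multiset.sort_eq m (· ≤ ·), Multiset.coe_nodup]
      exact h.imp (by intro a b; unfold CapparelliGap; omega)
    · have h' : (m.sort (· ≤ ·)).Pairwise
          (fun x y => (x < y → CapparelliGap x y) ∧ (y < x → CapparelliGap y x)) :=
        h.imp (by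
          intro a b hab
          refine ⟨fun _ => hab, fun hba => ?_⟩
          unfold CapparelliGap at hab
          omega)
      intro x hx y hy hxy
      rw [Multiset.mem_toFinset] at hx hy
      have hsymm : Std.Symm (fun x y : ℕ =>
          (x < y → CapparelliGap x y) ∧ (y < x → CapparelliGap y x)) :=
        ⟨fun a b hab => ⟨hab.2, hab.1⟩⟩
      have := h'.forall (Multiset.mem_sort _ |>.2 hx)
        (Multiset.mem_sort _ |>.2 hy) hxy.ne
      exact this.1 hxy
  · rintro ⟨h1, h2⟩
    have hs := Multiset.pairwise_sort m (· ≤ ·)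
    rw [← Multiset.sort_eq m (· ≤ ·), Multiset.coe_nodup] at h1
    refine (hs.and h1).imp_of_mem ?_
    intro a b ha hb hab
    refine h2 a ?_ b ?_ (lt_of_le_of_ne hab.1 hab.2)
    · simpa using ha
    · simpa using hb

end comb

/-- Capparelli's second identity. For every nonnegative integer `n`,
the number of partitions of `n` into distinct parts, none congruent to `2` or `4`
modulo `6`, equals the number of partitions `c₁ ≥ c₂ ≥ ⋯ ≥ c_s` of `n` such that no
part equals `2`, `c_j − c_{j+1} ≥ 2` for all `1 ≤ j < s`, and whenever `c_j − c_{j+1}`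
equals `2` or `3` one has either `c_j + c_{j+1} ≡ 0 (mod 6)` or both `c_j ≡ 0` and
`c_{j+1} ≡ 0 (mod 3)`. -/
theorem statement9 (n : ℕ) :
    Nat.card {p : n.Partition //
      p.parts.Nodup ∧ ∀ a ∈ p.parts, ¬(a % 6 = 2 ∨ a % 6 = 4)} =
    Nat.card {p : n.Partition //
      (∀ a ∈ p.parts, a ≠ 2) ∧ (p.parts.sort (· ≤ ·)).Chain' CapparelliGap} := by
  classical
  rw [cap_card n (6 * (n + 1) + 1) (by omega) _ (fun s => ∀ x ∈ s, CapOk x) ?_ ?_,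
    cap_card n (6 * (n + 1) + 1) (by omega) _
      (fun s => (∀ x ∈ s, x = 1 ∨ 3 ≤ x) ∧ CapPW s) ?_ ?_]
  · convert cap_count n
  · intro p
    have hc := cap_chain p.parts
    have hpos : ∀ a ∈ p.parts, 0 < a := fun a ha => p.parts_pos ha
    constructor
    · rintro ⟨h1, h2⟩
      obtain ⟨h3, h4⟩ := hc.1 h2
      refine ⟨h3, fun x hx => ?_, h4⟩
      have hx := Multiset.mem_toFinset.1 hx
      have := h1 x hx
      have := hpos x hx
      omega
    · rintro ⟨h1, h2, h3⟩
      refine ⟨fun a ha => ?_, hc.2 ⟨h1, h3⟩⟩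
      have := h2 a (Multiset.mem_toFinset.2 ha)
      omega
  · intro s hs h0
    have := hs.1 0 h0
    omega
  · intro p
    have hpos : ∀ a ∈ p.parts, 0 < a := fun a ha => p.parts_pos ha
    refine and_congr_right fun _ => ?_
    simp only [Multiset.mem_toFinset]
    exact ⟨fun h x hx => ⟨(hpos x hx).ne', h x hx⟩, fun h x hx => (h x hx).2⟩
  · intro s hs h0
    exact (hs 0 h0).1 rfl
end
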